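/- arXiv:1611.03364 — 4 statements merged into one kernel-verified Lean document; each statement's English description precedes it below -/
import Mathlib

section
/- For every z ∈ ℂ with Re(z) ≤ 0, lim_{m→∞} E[exp(z·S_m^α(t))] = exp(−t·(−z)^α); in particular, for every y ∈ ℝ, lim_{m→∞} E[exp(i·y·S_m^α(t))] = exp(−t·(−iy)^α). -/
open MeasureTheory ProbabilityTheory Filter

/-- Density of the jumps `Y_j`: `f_m(y) = c_m y^{-α-1} 1_{(1/m, m²)}(y)`,
with `c_m = α / (m^α (1 - m^{-3α}))`. -/
noncomputable def subDensity (α : ℝ) (m : ℕ) (y : ℝ) : ℝ :=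
  if y ∈ Set.Ioo (1 / (m : ℝ)) ((m : ℝ) ^ 2) then
    (α / ((m : ℝ) ^ α * (1 - (m : ℝ) ^ (-3 * α)))) * y ^ (-α - 1)
  else 0

/-- Poisson rate `t m^{2α} / Γ(1-α)`. -/
noncomputable def poissonRate (α t : ℝ) (m : ℕ) : ℝ :=
  t * (m : ℝ) ^ (2 * α) / Real.Gamma (1 - α)

/-- The compound Poisson process `S_m^α(t) = (1/m) ∑_{j=1}^{X} Y_j`. -/
noncomputable def subProc {Ω : Type} (X : ℕ → Ω → ℕ) (Y : ℕ → ℕ → Ω → ℝ) (m : ℕ) (ω : Ω) : ℝ :=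
  (1 / (m : ℝ)) * ∑ j ∈ Finset.range (X m ω), Y m j ω


open Complex in
theorem norm_exp_sub_one_le_two {z : ℂ} (hz : z.re ≤ 0) : ‖exp z - 1‖ ≤ 2 := by
  have h : ‖exp z‖ ≤ 1 := by rw [norm_exp]; exact Real.exp_le_one_iff.2 hz
  calc ‖exp z - 1‖ ≤ ‖exp z‖ + ‖(1 : ℂ)‖ := norm_sub_le _ _
    _ ≤ 2 := by rw [norm_one]; linarith

theorem norm_exp_sub_one_le_two_mul {z : ℂ} (hz : z.re ≤ 0) :
    ‖Complex.exp z - 1‖ ≤ 2 * ‖z‖ := by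
  rcases le_total ‖z‖ 1 with h | h
  · exact Complex.norm_exp_sub_one_le h
  · linarith [norm_exp_sub_one_le_two hz]

/-- An integrable majorant, up to a constant, of `(exp (z * u) - 1) * u ^ (-α - 1)`. -/
noncomputable def levyMajorant (α u : ℝ) : ℝ :=
  (Set.Ioc 0 1).indicator (fun u => u ^ (-α)) u + (Set.Ioi 1).indicator (fun u => u ^ (-α - 1)) u

theorem integrable_levyMajorant {α : ℝ} (hα : α ∈ Set.Ioo (0 : ℝ) 1) :
    Integrable (levyMajorant α) := by
  refine Integrable.add ?_ ?_
  · rw [integrable_indicator_iff measurableSet_Ioc, integrableOn_Ioc_iff_integrableOn_Ioo,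
      intervalIntegral.integrableOn_Ioo_rpow_iff one_pos]
    linarith [hα.2]
  · rw [integrable_indicator_iff measurableSet_Ioi]
    exact integrableOn_Ioi_rpow_of_lt (by linarith [hα.1]) one_pos

theorem norm_levyKernel_le {α R u : ℝ} {z : ℂ} (hz : z.re ≤ 0) (hR : ‖z‖ ≤ R) (hu : 0 < u) :
    ‖(Complex.exp (z * u) - 1) * ((u ^ (-α - 1) : ℝ) : ℂ)‖ ≤ 2 * (1 + R) * levyMajorant α u := by
  have hzu : (z * u).re ≤ 0 := by
    simpa using mul_nonpos_of_nonpos_of_nonneg hz hu.le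
  have hp : 0 < u ^ (-α - 1) := Real.rpow_pos_of_pos hu _
  have hR0 : 0 ≤ R := (norm_nonneg z).trans hR
  rw [norm_mul, Complex.norm_real, Real.norm_of_nonneg hp.le, levyMajorant]
  rcases le_or_gt u 1 with h | h
  · have h1 : u ^ (-α) = u * u ^ (-α - 1) := by
      rw [Real.rpow_sub_one hu.ne']; field_simp
    rw [Set.indicator_of_mem (show u ∈ Set.Ioc 0 1 from ⟨hu, h⟩), Set.indicator_of_notMem (by simpa using h), add_zero, h1,
      ← mul_assoc]
    refine mul_le_mul_of_nonneg_right ((norm_exp_sub_one_le_two_mul hzu).trans ?_) hp.le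
    rw [norm_mul, Complex.norm_real, Real.norm_of_nonneg hu.le]
    nlinarith
  · rw [Set.indicator_of_notMem (by simp [h]), Set.indicator_of_mem (show u ∈ Set.Ioi 1 from h), zero_add]
    refine mul_le_mul_of_nonneg_right ((norm_exp_sub_one_le_two hzu).trans ?_) hp.le
    linarith

theorem measurable_levyKernel (α : ℝ) (z : ℂ) :
    Measurable fun u : ℝ => (Complex.exp (z * u) - 1) * ((u ^ (-α - 1) : ℝ) : ℂ) := by
  fun_prop

theorem integrableOn_levyKernel {α : ℝ} (hα : α ∈ Set.Ioo (0 : ℝ) 1) {z : ℂ} (hz : z.re ≤ 0) :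
    IntegrableOn (fun u : ℝ => (Complex.exp (z * u) - 1) * ((u ^ (-α - 1) : ℝ) : ℂ))
      (Set.Ioi 0) := by
  refine Integrable.mono' ((integrable_levyMajorant hα).const_mul (2 * (1 + ‖z‖))).integrableOn
    (measurable_levyKernel α z).aestronglyMeasurable ?_
  filter_upwards [ae_restrict_mem measurableSet_Ioi] with u hu
  exact norm_levyKernel_le hz le_rfl hu

/-- The Laplace exponent of the unnormalised `α`-stable subordinator. -/
noncomputable def levyIntegral (α : ℝ) (z : ℂ) : ℂ :=
  ∫ u in Set.Ioi (0 : ℝ), (Complex.exp (z * u) - 1) * ((u ^ (-α - 1) : ℝ) : ℂ)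

theorem continuousOn_levyIntegral {α : ℝ} (hα : α ∈ Set.Ioo (0 : ℝ) 1) :
    ContinuousOn (levyIntegral α) {z | z.re ≤ 0} := by
  intro z₀ _
  refine tendsto_integral_filter_of_dominated_convergence
    (fun u => 2 * (1 + (‖z₀‖ + 1)) * levyMajorant α u)
    (.of_forall fun z => (measurable_levyKernel α z).aestronglyMeasurable) ?_
    ((integrable_levyMajorant hα).const_mul _).integrableOn ?_
  · have hball : ∀ᶠ z in nhdsWithin z₀ {z : ℂ | z.re ≤ 0}, ‖z‖ < ‖z₀‖ + 1 :=
      (continuous_norm.continuousWithinAt).eventually_lt_const (lt_add_one _)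
    filter_upwards [hball, self_mem_nhdsWithin] with z hz hz'
    filter_upwards [ae_restrict_mem measurableSet_Ioi] with u hu
    exact norm_levyKernel_le hz' hz.le hu
  · refine .of_forall fun u => ?_
    exact (Continuous.continuousWithinAt (by fun_prop))

theorem differentiableOn_levyIntegral {α : ℝ} (hα : α ∈ Set.Ioo (0 : ℝ) 1) :
    DifferentiableOn ℂ (levyIntegral α) {z | z.re < 0} := by
  intro z₀ (hz₀ : z₀.re < 0)
  have hopen : {z : ℂ | z.re < z₀.re / 2} ∈ nhds z₀ :=
    (isOpen_lt Complex.continuous_re continuous_const).mem_nhds (by simp; linarith)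
  refine (hasDerivAt_integral_of_dominated_loc_of_deriv_le
    (bound := fun u : ℝ => u ^ (-α) * Real.exp (-(-z₀.re / 2) * u ^ (1 : ℝ)))
    (F' := fun (z : ℂ) (u : ℝ) => (Complex.exp (z * u) * u) * ((u ^ (-α - 1) : ℝ) : ℂ))
    hopen (.of_forall fun z => (measurable_levyKernel α z).aestronglyMeasurable)
    (integrableOn_levyKernel hα hz₀.le)
    (Measurable.aestronglyMeasurable (by fun_prop)) ?_ ?_ ?_).2.differentiableAt.differentiableWithinAt
  · filter_upwards [ae_restrict_mem measurableSet_Ioi] with u (hu : 0 < u) z (hz : z.re < z₀.re / 2)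
    have h1 : u ^ (-α) = u * u ^ (-α - 1) := by
      rw [Real.rpow_sub_one hu.ne']; field_simp
    rw [norm_mul, norm_mul, Complex.norm_exp, Complex.norm_real, Complex.norm_real,
      Real.norm_of_nonneg hu.le, Real.norm_of_nonneg (Real.rpow_nonneg hu.le _), h1, Real.rpow_one,
      mul_comm (u * _), mul_assoc]
    refine mul_le_mul_of_nonneg_right (Real.exp_le_exp.2 ?_) (by positivity)
    simp only [Complex.mul_re, Complex.ofReal_re, Complex.ofReal_im, mul_zero, sub_zero]
    nlinarith
  · exact integrableOn_rpow_mul_exp_neg_mul_rpow (by linarith [hα.2]) one_pos (by linarith)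
  · refine .of_forall fun u z _ => ?_
    refine HasDerivAt.mul_const (HasDerivAt.sub_const _ ?_) _
    simpa using ((hasDerivAt_id z).mul_const (u : ℂ)).cexp

theorem integral_one_sub_exp_mul_rpow {α : ℝ} (hα : α ∈ Set.Ioo (0 : ℝ) 1) {r : ℝ} (hr : 0 < r) :
    ∫ u in Set.Ioi (0 : ℝ), (Real.exp (-(r * u)) - 1) * u ^ (-α - 1)
      = -(Real.Gamma (1 - α) / α * r ^ α) := by
  have hα0 : α ≠ 0 := hα.1.ne'
  have hbound : ∀ u : ℝ, 0 < u → |Real.exp (-(r * u)) - 1| ≤ min 1 (r * u) := by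
    intro u hu
    have : Real.exp (-(r * u)) ≤ 1 := Real.exp_le_one_iff.2 (by nlinarith)
    rw [abs_of_nonpos (by linarith)]
    exact le_min (by linarith [Real.exp_pos (-(r * u))]) (by linarith [Real.add_one_le_exp (-(r * u))])
  have hIBP := integral_Ioi_mul_deriv_eq_deriv_mul (a := 0) (a' := (0 : ℝ)) (b' := 0)
    (u := fun u : ℝ => Real.exp (-(r * u)) - 1) (v := fun u => -(u ^ (-α) / α))
    (u' := fun u => -(r * Real.exp (-(r * u)))) (v' := fun u => u ^ (-α - 1)) ?_ ?_ ?_ ?_ ?_ ?_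
  · rw [hIBP]
    have h := Real.integral_rpow_mul_exp_neg_mul_Ioi (a := 1 - α) (r := r) (by linarith [hα.2]) hr
    have h2 : ∫ u in Set.Ioi (0 : ℝ), -(r * Real.exp (-(r * u))) * -(u ^ (-α) / α)
        = r / α * ∫ u in Set.Ioi (0 : ℝ), u ^ (1 - α - 1) * Real.exp (-(r * u)) := by
      rw [← integral_const_mul]
      congr 1 with u
      rw [show 1 - α - 1 = -α by ring]; ring
    rw [h2, h, one_div, Real.inv_rpow hr.le, ← Real.rpow_neg hr.le,
      show -(1 - α) = α - 1 by ring, Real.rpow_sub_one hr.ne']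
    field_simp
    ring
  · intro u _
    simpa [mul_comm] using (((hasDerivAt_id u).const_mul r).neg.exp.sub_const 1)
  · intro u (hu : 0 < u)
    have := ((Real.hasDerivAt_rpow_const (p := -α) (Or.inl hu.ne')).div_const α).neg
    refine this.congr_deriv ?_
    field_simp
  · have := (integrableOn_levyKernel hα (z := -r) (by simpa using hr.le)).re
    refine this.congr (.of_forall fun u => ?_)
    simp only [Pi.mul_apply]
    rw [← Complex.ofReal_neg, ← Complex.ofReal_mul, ← Complex.ofReal_exp, ← Complex.ofReal_one,
      ← Complex.ofReal_sub, ← Complex.ofReal_mul, neg_mul]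
    simp only [RCLike.re_to_complex, Complex.ofReal_re]
  · have := (integrableOn_rpow_mul_exp_neg_mul_rpow (p := 1) (s := -α) (b := r)
      (by linarith [hα.2]) one_pos hr).const_mul (r / α)
    refine this.congr (.of_forall fun u => ?_)
    simp only [Pi.mul_apply, Real.rpow_one, neg_mul]
    ring
  · have h0 : Tendsto (fun u : ℝ => r / α * u ^ (1 - α)) (nhdsWithin 0 (Set.Ioi 0)) (nhds 0) := by
      have : ContinuousAt (fun u : ℝ => r / α * u ^ (1 - α)) 0 :=
        (Real.continuousAt_rpow_const _ _ (Or.inr (by linarith [hα.2]))).const_mul _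
      simpa [Real.zero_rpow (by linarith [hα.2] : 1 - α ≠ 0)] using this.tendsto.mono_left nhdsWithin_le_nhds
    refine squeeze_zero_norm' ?_ h0
    filter_upwards [self_mem_nhdsWithin] with u (hu : 0 < u)
    have hp := Real.rpow_pos_of_pos hu (-α)
    rw [Pi.mul_apply, norm_mul, norm_neg, Real.norm_eq_abs,
      Real.norm_of_nonneg (div_nonneg hp.le hα.1.le), show 1 - α = -α + 1 by ring,
      Real.rpow_add_one hu.ne', show r / α * (u ^ (-α) * u) = (r * u) * (u ^ (-α) / α) by ring]
    exact mul_le_mul_of_nonneg_right ((hbound u hu).trans (min_le_right _ _))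
      (div_nonneg hp.le hα.1.le)
  · have h0 : Tendsto (fun u : ℝ => u ^ (-α) / α) atTop (nhds 0) := by
      simpa using (tendsto_rpow_neg_atTop hα.1).div_const α
    refine squeeze_zero_norm' ?_ h0
    filter_upwards [eventually_gt_atTop 0] with u hu
    have hp := Real.rpow_pos_of_pos hu (-α)
    rw [Pi.mul_apply, norm_mul, norm_neg, Real.norm_eq_abs,
      Real.norm_of_nonneg (div_nonneg hp.le hα.1.le)]
    exact mul_le_of_le_one_left (div_nonneg hp.le hα.1.le) ((hbound u hu).trans (min_le_left _ _))

theorem levyIntegral_neg_ofReal {α : ℝ} (hα : α ∈ Set.Ioo (0 : ℝ) 1) {r : ℝ} (hr : 0 < r) :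
    levyIntegral α (-r) = -(Real.Gamma (1 - α) / α * (r : ℂ) ^ (α : ℂ)) := by
  have h := congrArg (fun x : ℝ => (x : ℂ)) (integral_one_sub_exp_mul_rpow hα hr)
  simp only [← integral_complex_ofReal] at h
  push_cast [Complex.ofReal_cpow hr.le] at h
  rw [← h, levyIntegral]
  simp only [neg_mul]

theorem levyIntegral_of_re_neg {α : ℝ} (hα : α ∈ Set.Ioo (0 : ℝ) 1) {z : ℂ} (hz : z.re < 0) :
    levyIntegral α z = -(Real.Gamma (1 - α) / α * (-z) ^ (α : ℂ)) := by
  have hopen : IsOpen {z : ℂ | z.re < 0} := isOpen_lt Complex.continuous_re continuous_const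
  have hd : DifferentiableOn ℂ (fun z : ℂ => -((Real.Gamma (1 - α) / α : ℂ) * (-z) ^ (α : ℂ)))
      {z | z.re < 0} := by
    intro z (hz : z.re < 0)
    have : -z ∈ Complex.slitPlane := Or.inl (by simpa using hz)
    exact ((differentiableAt_id.neg.cpow_const this).const_mul _).neg.differentiableWithinAt
  refine ((differentiableOn_levyIntegral hα).analyticOnNhd hopen).eqOn_of_preconnected_of_frequently_eq
    (hd.analyticOnNhd hopen) (convex_halfSpace_re_lt 0).isPreconnected (z₀ := -1) (by simp) ?_ hz
  have htend : Tendsto (fun n : ℕ => -(((1 + 1 / ((n : ℝ) + 1) : ℝ)) : ℂ)) atTop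
      (nhdsWithin (-1) {-1}ᶜ) := by
    refine tendsto_nhdsWithin_iff.2 ⟨?_, .of_forall fun n => ?_⟩
    · have := ((tendsto_one_div_add_atTop_nhds_zero_nat (𝕜 := ℝ)).const_add 1)
      simpa using (Complex.continuous_ofReal.tendsto _ |>.comp this).neg
    · have : (1 / ((n : ℝ) + 1) : ℝ) ≠ 0 := by positivity
      simp only [Set.mem_compl_iff, Set.mem_singleton_iff, neg_inj]
      norm_cast
      simpa using this
  refine htend.frequently (Eventually.frequently (.of_forall fun n => ?_))
  rw [levyIntegral_neg_ofReal hα (by positivity), neg_neg]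

theorem levyIntegral_eq {α : ℝ} (hα : α ∈ Set.Ioo (0 : ℝ) 1) {z : ℂ} (hz : z.re ≤ 0) :
    levyIntegral α z = -(Real.Gamma (1 - α) / α * (-z) ^ (α : ℂ)) := by
  have hcl : closure {z : ℂ | z.re < 0} = {z | z.re ≤ 0} := Complex.closure_setOfPred_re_lt 0
  refine Set.EqOn.of_subset_closure (s := {z : ℂ | z.re < 0})
    (fun z hz => levyIntegral_of_re_neg hα hz) (continuousOn_levyIntegral hα) ?_
    (fun z (hz : z.re < 0) => hz.le) hcl.ge hz
  intro z (hz : z.re ≤ 0)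
  have hc : ContinuousAt (fun x : ℂ => x ^ (α : ℂ)) (-z) :=
    Complex.continuousAt_cpow_const_of_re_pos (Or.inl (by simpa using hz)) (by simpa using hα.1)
  exact ((ContinuousAt.comp (f := fun z : ℂ => -z) hc continuous_neg.continuousAt).const_mul
    _).neg.continuousWithinAt

section CompoundPoisson

variable {Ω : Type*} [MeasurableSpace Ω] {μ : Measure Ω}

/-- Conditioning on the number of terms of a random sum. -/
theorem setIntegral_exp_sum [IsProbabilityMeasure μ] {X : Ω → ℕ} {Y : ℕ → Ω → ℝ}
    (hX : Measurable X) (hY : ∀ j, Measurable (Y j))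
    (hindep : iIndep (fun i : Option ℕ => i.elim (MeasurableSpace.comap X inferInstance)
        (fun j => MeasurableSpace.comap (Y j) inferInstance)) μ)
    {w φ : ℂ} (hφ : ∀ j, ∫ ω, Complex.exp (w * Y j ω) ∂μ = φ) (k : ℕ) :
    ∫ ω in X ⁻¹' {k}, Complex.exp (w * ((∑ j ∈ Finset.range (X ω), Y j ω : ℝ) : ℂ)) ∂μ
      = μ.real (X ⁻¹' {k}) * φ ^ k := by
  have hms : MeasurableSet (X ⁻¹' {k}) := hX (measurableSet_singleton k)
  let G : Option ℕ → Ω → ℂ := fun i =>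
    i.elim ((X ⁻¹' {k}).indicator 1) (fun j ω => Complex.exp (w * Y j ω))
  have hG : iIndepFun G μ := by
    rw [iIndepFun_iff_iIndep]
    refine iIndep_of_iIndep_of_le hindep fun i => ?_
    cases i with
    | none =>
      refine Measurable.comap_le ?_
      exact (Measurable.of_discrete (f := ({k} : Set ℕ).indicator (1 : ℕ → ℂ))).comp
        (comap_measurable X)
    | some j =>
      refine Measurable.comap_le ?_
      have hg : Measurable fun y : ℝ => Complex.exp (w * y) := by fun_prop
      exact hg.comp (comap_measurable (Y j))
  have hGm : ∀ i, Measurable (G i) := by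
    rintro (_ | j)
    · exact measurable_one.indicator hms
    · exact Measurable.cexp ((Complex.measurable_ofReal.comp (hY j)).const_mul w)
  have hinj : Function.Injective (Option.map (Fin.val : Fin k → ℕ)) :=
    Option.map_injective Fin.val_injective
  have key := (hG.precomp hinj).integral_fun_prod_eq_prod_integral
    (fun i => (hGm _).aestronglyMeasurable)
  rw [Fintype.prod_option] at key
  have h0 : ∫ ω, G none ω ∂μ = μ.real (X ⁻¹' {k}) := by
    simp only [G, Option.elim]
    rw [integral_indicator hms]
    simp [measureReal_def]
  have hsome : ∀ j, ∫ ω, G (some j) ω ∂μ = φ := hφ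
  simp only [Option.map_none, Option.map_some, h0, hsome, Finset.prod_const, Finset.card_univ,
    Fintype.card_fin] at key
  rw [← key, ← integral_indicator hms]
  congr 1 with ω
  rw [Fintype.prod_option]
  by_cases hω : X ω = k
  · have hmem : ω ∈ X ⁻¹' {k} := hω
    simp only [G, Option.map_none, Option.map_some, Option.elim]
    rw [Set.indicator_of_mem hmem, Set.indicator_of_mem hmem, Pi.one_apply, one_mul,
      Fin.prod_univ_eq_prod_range (fun j => Complex.exp (w * Y j ω)), ← Complex.exp_sum, hω,
      Complex.ofReal_sum, Finset.mul_sum]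
  · have hmem : ω ∉ X ⁻¹' {k} := hω
    simp only [G, Option.map_none, Option.elim]
    rw [Set.indicator_of_notMem hmem, Set.indicator_of_notMem hmem, zero_mul]

/-- The Laplace transform of a compound Poisson variable with nonnegative jumps. -/
theorem integral_exp_compoundPoisson [IsProbabilityMeasure μ] {X : Ω → ℕ} {Y : ℕ → Ω → ℝ}
    (hX : Measurable X) (hY : ∀ j, Measurable (Y j))
    (hindep : iIndep (fun i : Option ℕ => i.elim (MeasurableSpace.comap X inferInstance)
        (fun j => MeasurableSpace.comap (Y j) inferInstance)) μ)
    {r : ℝ} (hr : 0 ≤ r) (hXlaw : ∀ k : ℕ,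
      μ {ω | X ω = k} = ENNReal.ofReal (Real.exp (-r) * r ^ k / Nat.factorial k))
    (hYpos : ∀ j, ∀ᵐ ω ∂μ, 0 ≤ Y j ω)
    {w φ : ℂ} (hw : w.re ≤ 0) (hφ : ∀ j, ∫ ω, Complex.exp (w * Y j ω) ∂μ = φ) :
    ∫ ω, Complex.exp (w * ((∑ j ∈ Finset.range (X ω), Y j ω : ℝ) : ℂ)) ∂μ
      = Complex.exp (r * (φ - 1)) := by
  have hmeas : Measurable fun ω => ∑ j ∈ Finset.range (X ω), Y j ω := by
    have h : Measurable fun p : Ω × ℕ => ∑ j ∈ Finset.range p.2, Y j p.1 :=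
      measurable_from_prod_countable_left fun n =>
        Finset.measurable_fun_sum (Finset.range n) fun j _ => hY j
    exact h.comp (measurable_id.prodMk hX)
  have hint : Integrable
      (fun ω => Complex.exp (w * ((∑ j ∈ Finset.range (X ω), Y j ω : ℝ) : ℂ))) μ := by
    refine Integrable.of_bound (C := 1) (Measurable.aestronglyMeasurable
      (Measurable.cexp ((Complex.measurable_ofReal.comp hmeas).const_mul w))) ?_
    filter_upwards [ae_all_iff.2 hYpos] with ω hω
    rw [Complex.norm_exp, Real.exp_le_one_iff]
    simpa using mul_nonpos_of_nonpos_of_nonneg hw (Finset.sum_nonneg fun j _ => hω j)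
  have hun : ⋃ k, X ⁻¹' {k} = Set.univ := by ext; simp
  have hsum := hasSum_integral_iUnion (s := fun k : ℕ => X ⁻¹' {k})
    (fun k => hX (measurableSet_singleton k))
    (fun i j hij => (Set.disjoint_singleton.2 hij).preimage X) hint.integrableOn
  rw [hun, setIntegral_univ] at hsum
  refine hsum.unique ?_
  simp only [setIntegral_exp_sum hX hY hindep hφ]
  have hprob : ∀ k : ℕ, μ.real (X ⁻¹' {k}) = Real.exp (-r) * r ^ k / Nat.factorial k := by
    intro k
    have : X ⁻¹' {k} = {ω | X ω = k} := rfl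
    rw [measureReal_def, this, hXlaw, ENNReal.toReal_ofReal (by positivity)]
  have hexp := (NormedSpace.expSeries_div_hasSum_exp (r * φ : ℂ)).mul_left (Complex.exp (-r))
  rw [← Complex.exp_eq_exp_ℂ, ← Complex.exp_add] at hexp
  convert! hexp using 1
  · funext k
    rw [hprob]
    push_cast
    rw [mul_pow]
    ring
  · congr 1
    ring

end CompoundPoisson

theorem measurable_subDensity (α : ℝ) (m : ℕ) : Measurable (subDensity α m) :=
  Measurable.ite measurableSet_Ioo (by fun_prop) measurable_const

theorem subDensity_nonneg {α : ℝ} (hα : 0 < α) {m : ℕ} (hm : 2 ≤ m) (y : ℝ) :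
    0 ≤ subDensity α m y := by
  unfold subDensity
  split_ifs with h
  · have hm1 : (1 : ℝ) ≤ m := by exact_mod_cast (by omega : 1 ≤ m)
    have hy : 0 < y := lt_trans (by positivity) h.1
    have : (m : ℝ) ^ (-3 * α) ≤ 1 := Real.rpow_le_one_of_one_le_of_nonpos hm1 (by linarith)
    have : 0 ≤ 1 - (m : ℝ) ^ (-3 * α) := by linarith
    positivity
  · exact le_rfl

theorem subDensity_eq_zero_of_neg {α : ℝ} {m : ℕ} {y : ℝ} (hy : y < 0) :
    subDensity α m y = 0 :=
  if_neg fun h => (lt_irrefl y) (hy.trans_le ((by positivity : (0 : ℝ) ≤ 1 / m).trans h.1.le))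

/-- The Laplace exponent of the approximating process, in the rescaled variable `u = y / m`. -/
theorem poissonRate_mul_integral_subDensity (α t : ℝ) {m : ℕ} (hm : 2 ≤ m) (z : ℂ) :
    (poissonRate α t m : ℂ) *
        ∫ y, (subDensity α m y : ℂ) * (Complex.exp (z / m * y) - 1)
      = (t * α / Real.Gamma (1 - α) / (1 - (m : ℝ) ^ (-3 * α)) : ℝ) *
        ∫ u in Set.Ioi (0 : ℝ), (Set.Ioo (1 / (m : ℝ) ^ 2) (m : ℝ)).indicator
          (fun u => (Complex.exp (z * u) - 1) * ((u ^ (-α - 1) : ℝ) : ℂ)) u := by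
  have hm0 : (0 : ℝ) < m := by exact_mod_cast (by omega : 0 < m)
  have hmC : (m : ℂ) ≠ 0 := by exact_mod_cast hm0.ne'
  have hsub : Set.Ioo (1 / (m : ℝ) ^ 2) (m : ℝ) ⊆ Set.Ioi 0 :=
    fun u hu => lt_trans (by positivity) hu.1
  rw [setIntegral_indicator measurableSet_Ioo, Set.inter_eq_right.2 hsub,
    ← integral_indicator measurableSet_Ioo]
  have hcv := Measure.integral_comp_mul_left
    (fun y : ℝ => (subDensity α m y : ℂ) * (Complex.exp (z / m * y) - 1)) m
  rw [abs_of_pos (inv_pos.2 hm0), Complex.real_smul] at hcv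
  have hcv' : ∫ y, (subDensity α m y : ℂ) * (Complex.exp (z / m * y) - 1)
      = m * ∫ u : ℝ, (subDensity α m (m * u) : ℂ) * (Complex.exp (z / m * ((m * u : ℝ) : ℂ)) - 1) := by
    rw [hcv]
    push_cast
    field_simp
  rw [hcv', ← mul_assoc, ← integral_const_mul, ← integral_const_mul]
  congr 1 with u
  have hiff : (m : ℝ) * u ∈ Set.Ioo (1 / (m : ℝ)) ((m : ℝ) ^ 2) ↔
      u ∈ Set.Ioo (1 / (m : ℝ) ^ 2) (m : ℝ) := by
    simp only [Set.mem_Ioo, pow_two, ← div_div]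
    rw [mul_lt_mul_iff_right₀ hm0, div_lt_iff₀' hm0 (b := 1 / (m : ℝ))]
  by_cases hu : u ∈ Set.Ioo (1 / (m : ℝ) ^ 2) (m : ℝ)
  · have hu0 : 0 < u := hsub hu
    rw [Set.indicator_of_mem hu, subDensity, if_pos (hiff.2 hu), ← mul_assoc, ← mul_assoc]
    have harg : z / m * ((m * u : ℝ) : ℂ) = z * u := by
      push_cast
      field_simp
    have hcoef : poissonRate α t m * m *
        (α / ((m : ℝ) ^ α * (1 - (m : ℝ) ^ (-3 * α))) * ((m : ℝ) * u) ^ (-α - 1))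
        = t * α / Real.Gamma (1 - α) / (1 - (m : ℝ) ^ (-3 * α)) * u ^ (-α - 1) := by
      have hp : (0 : ℝ) < (m : ℝ) ^ α := Real.rpow_pos_of_pos hm0 α
      rw [poissonRate, Real.mul_rpow hm0.le hu0.le, Real.rpow_sub_one hm0.ne',
        Real.rpow_neg hm0.le, two_mul α, Real.rpow_add hm0]
      generalize 1 - (m : ℝ) ^ (-3 * α) = d
      field_simp
    rw [harg, mul_right_comm _ (Complex.exp (z * u) - 1) _, ← Complex.ofReal_mul, ← hcoef]
    push_cast
    ring
  · rw [Set.indicator_of_notMem hu, subDensity, if_neg (mt hiff.1 hu)]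
    simp

theorem tendsto_truncated_levyIntegral {α : ℝ} (hα : α ∈ Set.Ioo (0 : ℝ) 1) {z : ℂ}
    (hz : z.re ≤ 0) :
    Tendsto (fun m : ℕ => ∫ u in Set.Ioi (0 : ℝ), (Set.Ioo (1 / (m : ℝ) ^ 2) (m : ℝ)).indicator
      (fun u => (Complex.exp (z * u) - 1) * ((u ^ (-α - 1) : ℝ) : ℂ)) u)
      atTop (nhds (levyIntegral α z)) := by
  refine tendsto_integral_of_dominated_convergence _
    (fun m => ((measurable_levyKernel α z).indicator measurableSet_Ioo).aestronglyMeasurable)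
    (integrableOn_levyKernel hα hz).norm
    (fun m => .of_forall fun u => norm_indicator_le_norm_self _ _) ?_
  filter_upwards [ae_restrict_mem measurableSet_Ioi] with u (hu : 0 < u)
  have h1 : Tendsto (fun m : ℕ => 1 / (m : ℝ) ^ 2) atTop (nhds 0) := by
    simpa [Function.comp_def] using tendsto_inv_atTop_zero.comp
      ((tendsto_pow_atTop two_ne_zero).comp (tendsto_natCast_atTop_atTop (R := ℝ)))
  refine tendsto_const_nhds.congr' ?_
  filter_upwards [h1.eventually_lt_const hu,
    tendsto_natCast_atTop_atTop.eventually_gt_atTop u] with m h h'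
  exact (Set.indicator_of_mem (show u ∈ Set.Ioo (1 / (m : ℝ) ^ 2) (m : ℝ) from ⟨h, h'⟩)
    (fun u : ℝ => (Complex.exp (z * u) - 1) * ((u ^ (-α - 1) : ℝ) : ℂ))).symm

section StableLimit

variable {Ω : Type} [MeasurableSpace Ω] {μ : Measure Ω}

theorem integral_exp_of_map_eq [IsProbabilityMeasure μ] {α : ℝ} (hα : 0 < α) {m : ℕ} (hm : 2 ≤ m) {Y : Ω → ℝ}
    (hY : Measurable Y)
    (hlaw : μ.map Y = volume.withDensity (fun y => ENNReal.ofReal (subDensity α m y)))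
    (hpos : ∀ᵐ ω ∂μ, 0 ≤ Y ω) {w : ℂ} (hw : w.re ≤ 0) :
    ∫ ω, Complex.exp (w * Y ω) ∂μ
      = 1 + ∫ y, (subDensity α m y : ℂ) * (Complex.exp (w * y) - 1) := by
  have hint : Integrable (fun ω => Complex.exp (w * Y ω)) μ := by
    refine Integrable.of_bound (C := 1) (Measurable.aestronglyMeasurable
      (Measurable.cexp ((Complex.measurable_ofReal.comp hY).const_mul w))) ?_
    filter_upwards [hpos] with ω hω
    rw [Complex.norm_exp, Real.exp_le_one_iff]
    simpa using mul_nonpos_of_nonpos_of_nonneg hw hω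
  have hsub : ∫ ω, (Complex.exp (w * Y ω) - 1) ∂μ
      = ∫ y, (subDensity α m y : ℂ) * (Complex.exp (w * y) - 1) := by
    rw [← integral_map (φ := Y) (f := fun y : ℝ => Complex.exp (w * y) - 1) hY.aemeasurable
      (Measurable.aestronglyMeasurable (by fun_prop)), hlaw,
      integral_withDensity_eq_integral_toReal_smul (measurable_subDensity α m).ennreal_ofReal
        (.of_forall fun _ => ENNReal.ofReal_lt_top)]
    congr 1 with y
    rw [ENNReal.toReal_ofReal (subDensity_nonneg hα hm y), Complex.real_smul]
  rw [← hsub, integral_sub hint (integrable_const _)]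
  simp

theorem ae_nonneg_of_map_eq {α : ℝ} {m : ℕ} {Y : Ω → ℝ} (hY : Measurable Y)
    (hlaw : μ.map Y = volume.withDensity (fun y => ENNReal.ofReal (subDensity α m y))) :
    ∀ᵐ ω ∂μ, 0 ≤ Y ω := by
  refine ae_of_ae_map (p := fun y : ℝ => 0 ≤ y) hY.aemeasurable ?_
  rw [hlaw, ae_withDensity_iff (measurable_subDensity α m).ennreal_ofReal]
  refine .of_forall fun y hy => ?_
  contrapose! hy
  rw [subDensity_eq_zero_of_neg hy, ENNReal.ofReal_zero]

theorem tendsto_integral_exp_subProc [IsProbabilityMeasure μ]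
    {α : ℝ} (hα : α ∈ Set.Ioo (0 : ℝ) 1) {t : ℝ} (ht : 0 < t)
    {X : ℕ → Ω → ℕ} {Y : ℕ → ℕ → Ω → ℝ}
    (hXmeas : ∀ m, Measurable (X m)) (hYmeas : ∀ m j, Measurable (Y m j))
    (hX : ∀ m, 2 ≤ m → ∀ k : ℕ,
      μ {ω | X m ω = k} = ENNReal.ofReal
        (Real.exp (-(poissonRate α t m)) * poissonRate α t m ^ k / Nat.factorial k))
    (hY : ∀ m, 2 ≤ m → ∀ j,
      Measure.map (Y m j) μ = volume.withDensity (fun y => ENNReal.ofReal (subDensity α m y)))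
    (hindep : ∀ m, 2 ≤ m →
      iIndep (fun i : Option ℕ => i.elim (MeasurableSpace.comap (X m) inferInstance)
        (fun j => MeasurableSpace.comap (Y m j) inferInstance)) μ)
    {z : ℂ} (hz : z.re ≤ 0) :
    Tendsto (fun m : ℕ => ∫ ω, Complex.exp (z * (subProc X Y m ω : ℂ)) ∂μ) atTop
      (nhds (Complex.exp (-(t : ℂ) * (-z) ^ (α : ℂ)))) := by
  have hΓ : 0 < Real.Gamma (1 - α) := Real.Gamma_pos_of_pos (by linarith [hα.2])
  have hcoef : Tendsto
      (fun m : ℕ => t * α / Real.Gamma (1 - α) / (1 - (m : ℝ) ^ (-3 * α))) atTop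
      (nhds (t * α / Real.Gamma (1 - α))) := by
    have h := (tendsto_rpow_neg_atTop (y := 3 * α) (by linarith [hα.1])).comp
      (tendsto_natCast_atTop_atTop (R := ℝ))
    simpa [Function.comp_def, Pi.div_def] using
      (tendsto_const_nhds (x := t * α / Real.Gamma (1 - α))).div (h.const_sub 1) (by norm_num)
  have hlim := (((Complex.continuous_ofReal.tendsto _).comp hcoef).mul
    (tendsto_truncated_levyIntegral hα hz)).cexp
  have hval : ((t * α / Real.Gamma (1 - α) : ℝ) : ℂ) * levyIntegral α z
      = -(t : ℂ) * (-z) ^ (α : ℂ) := by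
    have h1 : (Real.Gamma (1 - α) : ℂ) ≠ 0 := by exact_mod_cast hΓ.ne'
    have h2 : (α : ℂ) ≠ 0 := by exact_mod_cast hα.1.ne'
    rw [levyIntegral_eq hα hz]
    push_cast
    field_simp
  rw [hval] at hlim
  refine hlim.congr' ?_
  filter_upwards [eventually_ge_atTop 2] with m hm
  have hw : (z / m).re ≤ 0 := by
    rw [Complex.div_natCast_re]
    exact div_nonpos_of_nonpos_of_nonneg hz m.cast_nonneg
  have hYpos := fun j => ae_nonneg_of_map_eq (hYmeas m j) (hY m hm j)
  have hrate : 0 ≤ poissonRate α t m := by unfold poissonRate; positivity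
  have h := integral_exp_compoundPoisson (hXmeas m) (hYmeas m) (hindep m hm) hrate (hX m hm)
    hYpos hw
    (fun j => integral_exp_of_map_eq hα.1 hm (hYmeas m j) (hY m hm j) (hYpos j) hw)
  rw [add_sub_cancel_left, poissonRate_mul_integral_subDensity α t hm z] at h
  refine h.symm.trans (integral_congr_ae (.of_forall fun ω => ?_))
  simp only [subProc]
  congr 1
  push_cast
  ring

end StableLimit

theorem stmt_8 {Ω : Type} [MeasurableSpace Ω] (μ : Measure Ω) [IsProbabilityMeasure μ]
    (α : ℝ) (hα : α ∈ Set.Ioo (0 : ℝ) 1) (t : ℝ) (ht : 0 < t)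
    (X : ℕ → Ω → ℕ) (Y : ℕ → ℕ → Ω → ℝ)
    (hXmeas : ∀ m, Measurable (X m)) (hYmeas : ∀ m j, Measurable (Y m j))
    (hX : ∀ m, 2 ≤ m → ∀ k : ℕ,
      μ {ω | X m ω = k} = ENNReal.ofReal
        (Real.exp (-(poissonRate α t m)) * poissonRate α t m ^ k / Nat.factorial k))
    (hY : ∀ m, 2 ≤ m → ∀ j,
      Measure.map (Y m j) μ = volume.withDensity (fun y => ENNReal.ofReal (subDensity α m y)))
    (hindep : ∀ m, 2 ≤ m →
      iIndep (fun i : Option ℕ => i.elim (MeasurableSpace.comap (X m) inferInstance)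
        (fun j => MeasurableSpace.comap (Y m j) inferInstance)) μ) :
    (∀ z : ℂ, z.re ≤ 0 →
      Tendsto (fun m : ℕ => ∫ ω, Complex.exp (z * (subProc X Y m ω : ℂ)) ∂μ) atTop
        (nhds (Complex.exp (-(t : ℂ) * (-z) ^ (α : ℂ))))) ∧
    (∀ y : ℝ, Tendsto
      (fun m : ℕ => ∫ ω, Complex.exp (Complex.I * (y : ℂ) * (subProc X Y m ω : ℂ)) ∂μ) atTop
        (nhds (Complex.exp (-(t : ℂ) * (-(Complex.I * (y : ℂ))) ^ (α : ℂ))))) := by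
  refine ⟨fun z hz => tendsto_integral_exp_subProc hα ht hXmeas hYmeas hX hY hindep hz, fun y => ?_⟩
  exact tendsto_integral_exp_subProc hα ht hXmeas hYmeas hX hY hindep (by simp)
end

section
/- There exists a constant C(α) > 0, depending only on α, such that for every integer k ≥ 1 and every integer m ≥ 2 with m ≥ (Γ(1−α)/t)^{1/(2α)}, the moments of S_m^α(t) satisfy E[(S_m^α(t))^k] ≤ C(α)^k · t^k · m^{k + 2αk − 3α} · ((k+1)/log(k+2))^{k+1}. -/
open MeasureTheory ProbabilityTheory Filter

open scoped ENNReal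

/-- Moment bound for a Poisson variable of rate `r ≥ 1`, from `x ≤ exp (x - 1)` and the
moment generating function evaluated at `log (1 + (k + 1) / r)`. -/
lemma tsum_poisson_mul_pow_le {r : ℝ} (hr : 1 ≤ r) {k : ℕ} (hk : 1 ≤ k) :
    ∑' n : ℕ, ENNReal.ofReal (Real.exp (-r) * r ^ n / n.factorial) * (n : ℝ≥0∞) ^ k ≤
      ENNReal.ofReal (Real.exp 1 * r ^ k * (k / Real.log (k + 2)) ^ k) := by
  have hr0 : 0 < r := by linarith
  have hk0 : (0 : ℝ) < k := by exact_mod_cast hk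
  set q : ℝ := 1 + (k + 1) / r with hq
  have hq1 : 1 < q := by rw [hq]; linarith [show 0 < ((k : ℝ) + 1) / r by positivity]
  have hlog : 0 < Real.log ((k : ℝ) + 2) := Real.log_pos (by linarith)
  have hlogq : 0 < Real.log q := Real.log_pos hq1
  have hbern : Real.log (k + 2) ≤ r * Real.log q := by
    have h := one_add_mul_self_le_rpow_one_add (s := (k + 1) / r)
      (by linarith [show 0 < ((k : ℝ) + 1) / r by positivity]) hr
    rw [mul_div_cancel₀ _ hr0.ne', ← hq] at h
    rw [← Real.log_rpow (by linarith)]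
    exact Real.log_le_log (by linarith) (by linarith)
  set A : ℝ := r * (k / Real.log (k + 2)) with hA
  have hA0 : 0 < A := by positivity
  have hpt : ∀ n : ℕ, (n : ℝ) ^ k ≤ A ^ k * Real.exp (-k) * q ^ n := by
    intro n
    have h1 : (n : ℝ) ≤ A * (Real.log q * n / k) := by
      have : A * (Real.log q * n / k) = (r * Real.log q) / Real.log (k + 2) * n := by
        rw [hA]; field_simp
      rw [this]
      exact le_mul_of_one_le_left (by positivity) ((one_le_div hlog).2 hbern)
    have h2 : Real.log q * n / k ≤ Real.exp (Real.log q * n / k - 1) := by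
      linarith [Real.add_one_le_exp (Real.log q * n / k - 1)]
    calc (n : ℝ) ^ k ≤ (A * Real.exp (Real.log q * n / k - 1)) ^ k := by
          gcongr
          exact h1.trans (by gcongr)
      _ = A ^ k * Real.exp (-k) * q ^ n := by
          have hqn : q ^ n = Real.exp (n * Real.log q) := by
            rw [Real.exp_nat_mul, Real.exp_log (by linarith)]
          rw [mul_pow, ← Real.exp_nat_mul, mul_assoc, hqn, ← Real.exp_add]
          congr 2
          field_simp
          ring
  clear_value A q
  have hsum : HasSum (fun n : ℕ => A ^ k * Real.exp (-k) * Real.exp (-r) * ((r * q) ^ n / n.factorial))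
      (A ^ k * Real.exp (-k) * Real.exp (-r) * Real.exp (r * q)) := by
    have := NormedSpace.expSeries_div_hasSum_exp (r * q)
    rw [← Real.exp_eq_exp_ℝ] at this
    exact this.mul_left _
  have hrq : r * q = r + (k + 1) := by rw [hq]; field_simp
  calc _ ≤ ∑' n : ℕ, ENNReal.ofReal
        (A ^ k * Real.exp (-k) * Real.exp (-r) * ((r * q) ^ n / n.factorial)) := by
        refine ENNReal.tsum_le_tsum fun n => ?_
        rw [← ENNReal.ofReal_natCast, ← ENNReal.ofReal_pow (by positivity),
          ← ENNReal.ofReal_mul (by positivity)]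
        refine ENNReal.ofReal_le_ofReal ?_
        calc _ ≤ Real.exp (-r) * r ^ n / n.factorial * (A ^ k * Real.exp (-k) * q ^ n) := by
              gcongr
              exact hpt n
          _ = _ := by rw [mul_pow]; ring
    _ = ENNReal.ofReal (A ^ k * Real.exp (-k) * Real.exp (-r) * Real.exp (r * q)) := by
        rw [← hsum.tsum_eq, ENNReal.ofReal_tsum_of_nonneg _ hsum.summable]
        intro n
        have : 0 < q := by linarith
        positivity
    _ ≤ _ := by
        refine ENNReal.ofReal_le_ofReal (le_of_eq ?_)
        rw [mul_assoc, mul_assoc, ← Real.exp_add, ← Real.exp_add, hrq, hA, mul_pow]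
        rw [show -(k : ℝ) + (-r + (r + (k + 1))) = 1 by ring]
        ring

/-- Bound for the moments of the jump distribution. -/
lemma lintegral_enorm_pow_subDensity_le {α : ℝ} (hα : α ∈ Set.Ioo (0 : ℝ) 1) {m k : ℕ}
    (hm : 2 ≤ m) (hk : 1 ≤ k) :
    ∫⁻ y, ‖y‖ₑ ^ k ∂(volume.withDensity fun y => ENNReal.ofReal (subDensity α m y)) ≤
      ENNReal.ofReal (α / ((1 - 2 ^ (-3 * α)) * (1 - α)) * (m : ℝ) ^ (2 * (k : ℝ) - 3 * α)) := by
  obtain ⟨hα0, hα1⟩ := hα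
  have hm2 : (2 : ℝ) ≤ m := by exact_mod_cast hm
  have hm0 : (0 : ℝ) < m := by linarith
  have hk1 : (1 : ℝ) ≤ k := by exact_mod_cast hk
  have h2 : (0 : ℝ) < 1 - 2 ^ (-3 * α) := by
    linarith [Real.rpow_lt_one_of_one_lt_of_neg (one_lt_two) (show -3 * α < 0 by linarith)]
  have hm3 : (1 : ℝ) - 2 ^ (-3 * α) ≤ 1 - (m : ℝ) ^ (-3 * α) := by
    linarith [Real.rpow_le_rpow_of_nonpos two_pos hm2 (show -3 * α ≤ 0 by linarith)]
  have hmc : 0 < 1 - (m : ℝ) ^ (-3 * α) := by linarith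
  set c : ℝ := α / ((m : ℝ) ^ α * (1 - (m : ℝ) ^ (-3 * α))) with hc
  have hc0 : 0 < c := by positivity
  have hmeas : Measurable fun y => ENNReal.ofReal (subDensity α m y) := by
    unfold subDensity
    refine ENNReal.measurable_ofReal.comp (Measurable.ite measurableSet_Ioo ?_ measurable_const)
    fun_prop
  have hle : (1 : ℝ) / m ≤ (m : ℝ) ^ 2 := by
    rw [div_le_iff₀ hm0]; nlinarith
  have hexp : -1 < (k : ℝ) - α - 1 := by linarith
  have hint : IntegrableOn (fun y : ℝ => c * y ^ ((k : ℝ) - α - 1))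
      (Set.Ioo (1 / (m : ℝ)) ((m : ℝ) ^ 2)) :=
    (((intervalIntegrable_iff_integrableOn_Ioc_of_le hle).1
      (intervalIntegral.intervalIntegrable_rpow' hexp)).mono_set Set.Ioo_subset_Ioc_self).const_mul c
  rw [lintegral_withDensity_eq_lintegral_mul _ hmeas (by fun_prop)]
  calc _ = ∫⁻ y in Set.Ioo (1 / (m : ℝ)) ((m : ℝ) ^ 2),
          ENNReal.ofReal (c * y ^ ((k : ℝ) - α - 1)) := by
        rw [← lintegral_indicator measurableSet_Ioo]
        refine lintegral_congr fun y => ?_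
        by_cases hy : y ∈ Set.Ioo (1 / (m : ℝ)) ((m : ℝ) ^ 2)
        · have hy0 : 0 < y := lt_trans (by positivity) hy.1
          rw [Set.indicator_of_mem hy, Pi.mul_apply, subDensity, if_pos hy, ← hc,
            Real.enorm_eq_ofReal hy0.le, ← ENNReal.ofReal_pow hy0.le,
            ← ENNReal.ofReal_mul (by positivity), mul_assoc, ← Real.rpow_natCast,
            ← Real.rpow_add hy0]
          congr 3
          ring
        · rw [Set.indicator_of_notMem hy, Pi.mul_apply, subDensity, if_neg hy]
          simp
    _ = ENNReal.ofReal (∫ y in Set.Ioo (1 / (m : ℝ)) ((m : ℝ) ^ 2),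
          c * y ^ ((k : ℝ) - α - 1)) := by
        refine (ofReal_integral_eq_lintegral_ofReal hint ?_).symm
        filter_upwards [ae_restrict_mem measurableSet_Ioo] with y hy
        have hy0 : 0 < y := lt_trans (by positivity) hy.1
        show 0 ≤ c * y ^ ((k : ℝ) - α - 1)
        positivity
    _ ≤ _ := by
        refine ENNReal.ofReal_le_ofReal ?_
        rw [integral_const_mul, ← integral_Ioc_eq_integral_Ioo,
          ← intervalIntegral.integral_of_le hle, integral_rpow (Or.inl hexp), sub_add_cancel]
        have hpow : ((m : ℝ) ^ 2) ^ ((k : ℝ) - α) = (m : ℝ) ^ α * (m : ℝ) ^ (2 * (k : ℝ) - 3 * α) := by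
          rw [← Real.rpow_add hm0, ← Real.rpow_natCast, ← Real.rpow_mul hm0.le]
          congr 1
          push_cast
          ring
        have hka : 1 - α ≤ k - α := by linarith
        have h1a : 0 < 1 - α := by linarith
        calc _ ≤ c * (((m : ℝ) ^ 2) ^ ((k : ℝ) - α) / (1 - α)) := by
              gcongr
              have : 0 ≤ (1 / (m : ℝ)) ^ ((k : ℝ) - α) := by positivity
              linarith
          _ = α / ((1 - (m : ℝ) ^ (-3 * α)) * (1 - α)) * (m : ℝ) ^ (2 * (k : ℝ) - 3 * α) := by
              have : (m : ℝ) ^ α ≠ 0 := by positivity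
              rw [hpow, hc]
              field_simp
          _ ≤ _ := by gcongr

/-- Moments of a random sum `∑_{j < N} Y j` whose number of terms is independent of each term. -/
lemma lintegral_enorm_sum_range_pow_le {Ω : Type*} [MeasurableSpace Ω] {μ : Measure Ω}
    {N : Ω → ℕ} {Y : ℕ → Ω → ℝ} (hN : Measurable N) (hY : ∀ j, Measurable (Y j))
    (hind : ∀ j, IndepFun N (Y j) μ) {k : ℕ} (hk : 1 ≤ k) {M : ℝ≥0∞}
    (hM : ∀ j, ∫⁻ ω, ‖Y j ω‖ₑ ^ k ∂μ ≤ M) :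
    ∫⁻ ω, ‖∑ j ∈ Finset.range (N ω), Y j ω‖ₑ ^ k ∂μ ≤
      (∑' n : ℕ, μ {ω | N ω = n} * (n : ℝ≥0∞) ^ k) * M := by
  obtain ⟨l, rfl⟩ : ∃ l, k = l + 1 := ⟨k - 1, by omega⟩
  have hset : ∀ n : ℕ, MeasurableSet {ω | N ω = n} := fun n => hN (measurableSet_singleton n)
  have hpt : ∀ ω, ‖∑ j ∈ Finset.range (N ω), Y j ω‖ₑ ^ (l + 1) ≤
      ∑' n : ℕ, (n : ℝ≥0∞) ^ l * ∑ j ∈ Finset.range n,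
        (({n} : Set ℕ).indicator (fun _ => (1 : ℝ≥0∞)) (N ω) * ‖Y j ω‖ₑ ^ (l + 1)) := by
    intro ω
    refine le_trans ?_ (ENNReal.le_tsum (N ω))
    simp only [Set.mem_singleton_iff, Set.indicator_of_mem, one_mul]
    calc _ ≤ (∑ j ∈ Finset.range (N ω), ‖Y j ω‖ₑ) ^ (l + 1) := by
          gcongr
          exact enorm_sum_le _ _
      _ ≤ _ := by
          have h := ENNReal.rpow_sum_le_const_mul_sum_rpow (Finset.range (N ω))
            (fun j => ‖Y j ω‖ₑ) (p := ((l + 1 : ℕ) : ℝ)) (by push_cast; linarith [l.cast_nonneg (α := ℝ)])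
          rw [show ((l + 1 : ℕ) : ℝ) - 1 = (l : ℕ) by push_cast; ring] at h
          simpa only [ENNReal.rpow_natCast, Finset.card_range] using h
  have hterm : ∀ n j, ∫⁻ ω, ({n} : Set ℕ).indicator (fun _ => (1 : ℝ≥0∞)) (N ω) *
      ‖Y j ω‖ₑ ^ (l + 1) ∂μ ≤ μ {ω | N ω = n} * M := by
    intro n j
    have h1 : Measurable fun i => ({n} : Set ℕ).indicator (fun _ => (1 : ℝ≥0∞)) i :=
      measurable_of_countable _
    have h2 : Measurable fun y : ℝ => ‖y‖ₑ ^ (l + 1) := by fun_prop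
    have := lintegral_mul_eq_lintegral_mul_lintegral_of_indepFun (h1.comp hN) (h2.comp (hY j))
      ((hind j).comp h1 h2)
    simp only [Pi.mul_apply, Function.comp_apply] at this
    rw [this]
    gcongr
    · rw [← lintegral_indicator_one (hset n)]
      refine le_of_eq (lintegral_congr fun ω => ?_)
      simp [Set.indicator_apply]
    · exact hM j
  have hmeas : ∀ n j, Measurable fun ω => ({n} : Set ℕ).indicator (fun _ => (1 : ℝ≥0∞)) (N ω) *
      ‖Y j ω‖ₑ ^ (l + 1) := fun n j =>
    ((measurable_of_countable fun i => ({n} : Set ℕ).indicator (fun _ => (1 : ℝ≥0∞)) i).comp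
      hN).mul ((hY j).enorm.pow_const _)
  calc _ ≤ _ := lintegral_mono hpt
    _ = ∑' n : ℕ, (n : ℝ≥0∞) ^ l * ∑ j ∈ Finset.range n,
        ∫⁻ ω, ({n} : Set ℕ).indicator (fun _ => (1 : ℝ≥0∞)) (N ω) * ‖Y j ω‖ₑ ^ (l + 1) ∂μ := by
        rw [lintegral_tsum fun n => ((Finset.measurable_fun_sum _
          fun j _ => hmeas n j).const_mul _).aemeasurable]
        congr 1 with n
        rw [lintegral_const_mul _ (Finset.measurable_fun_sum _ fun j _ => hmeas n j),
          lintegral_finsetSum _ fun j _ => hmeas n j]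
    _ ≤ ∑' n : ℕ, (n : ℝ≥0∞) ^ l * ∑ j ∈ Finset.range n, μ {ω | N ω = n} * M := by
        gcongr with n j hj
        exact hterm n j
    _ = _ := by
        rw [← ENNReal.tsum_mul_right]
        congr 1 with n
        rw [Finset.sum_const, Finset.card_range, nsmul_eq_mul, pow_succ]
        ring

theorem stmt_9 {Ω : Type} [MeasurableSpace Ω] (μ : Measure Ω) [IsProbabilityMeasure μ]
    (α : ℝ) (hα : α ∈ Set.Ioo (0 : ℝ) 1)
    (X : ℝ → ℕ → Ω → ℕ) (Y : ℕ → ℕ → Ω → ℝ)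
    (hXmeas : ∀ t m, Measurable (X t m)) (hYmeas : ∀ m j, Measurable (Y m j))
    (hX : ∀ t : ℝ, 0 < t → ∀ m, 2 ≤ m → ∀ k : ℕ,
      μ {ω | X t m ω = k} = ENNReal.ofReal
        (Real.exp (-(poissonRate α t m)) * poissonRate α t m ^ k / Nat.factorial k))
    (hY : ∀ m, 2 ≤ m → ∀ j,
      Measure.map (Y m j) μ = volume.withDensity (fun y => ENNReal.ofReal (subDensity α m y)))
    (hindep : ∀ t : ℝ, 0 < t → ∀ m, 2 ≤ m →
      iIndep (fun i : Option ℕ => i.elim (MeasurableSpace.comap (X t m) inferInstance)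
        (fun j => MeasurableSpace.comap (Y m j) inferInstance)) μ) :
    ∃ C : ℝ, 0 < C ∧ ∀ t : ℝ, 0 < t → ∀ k : ℕ, 1 ≤ k → ∀ m : ℕ, 2 ≤ m →
      (Real.Gamma (1 - α) / t) ^ ((1 : ℝ) / (2 * α)) ≤ (m : ℝ) →
      (∫ ω, (subProc (X t) Y m ω) ^ k ∂μ) ≤
        C ^ k * t ^ k * (m : ℝ) ^ ((k : ℝ) + 2 * α * k - 3 * α) *
          (((k : ℝ) + 1) / Real.log ((k : ℝ) + 2)) ^ (k + 1) := by
  obtain ⟨hα0, hα1⟩ := id hα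
  have hΓ : 0 < Real.Gamma (1 - α) := Real.Gamma_pos_of_pos (by linarith)
  have h2 : (0 : ℝ) < 1 - 2 ^ (-3 * α) := by
    linarith [Real.rpow_lt_one_of_one_lt_of_neg (one_lt_two) (show -3 * α < 0 by linarith)]
  have h1a : 0 < 1 - α := by linarith
  set D : ℝ := α / ((1 - 2 ^ (-3 * α)) * (1 - α)) with hD
  have hD0 : 0 < D := by positivity
  refine ⟨(Real.exp 1 * D + 1) / Real.Gamma (1 - α), by positivity, ?_⟩
  intro t ht k hk m hm hmt
  have hm0 : (0 : ℝ) < m := by exact_mod_cast (by omega : 0 < m)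
  have hk0 : (0 : ℝ) < k := by exact_mod_cast hk
  have hlog : 0 < Real.log ((k : ℝ) + 2) := Real.log_pos (by linarith)
  set r := poissonRate α t m with hrdef
  have hr : 1 ≤ r := by
    have h := Real.rpow_le_rpow (by positivity) hmt (show 0 ≤ 2 * α by linarith)
    rw [← Real.rpow_mul (by positivity), one_div_mul_cancel (by positivity), Real.rpow_one,
      div_le_iff₀ ht] at h
    rw [hrdef, poissonRate, one_le_div hΓ]
    linarith
  have hind : ∀ j, IndepFun (X t m) (Y m j) μ := fun j =>
    (hindep t ht m hm).indep (i := none) (j := some j) (by simp)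
  have hM : ∀ j, ∫⁻ ω, ‖Y m j ω‖ₑ ^ k ∂μ ≤
      ENNReal.ofReal (D * (m : ℝ) ^ (2 * (k : ℝ) - 3 * α)) := by
    intro j
    have h := lintegral_enorm_pow_subDensity_le hα hm hk
    rw [← hY m hm j, lintegral_map (by fun_prop) (hYmeas m j)] at h
    exact h
  have hS := lintegral_enorm_sum_range_pow_le (hXmeas t m) (hYmeas m) hind hk hM
  simp_rw [hX t ht m hm, ← hrdef] at hS
  have hS' := hS.trans (mul_le_mul_left (tsum_poisson_mul_pow_le hr hk) _)
  have hint : ∫ ω, (∑ j ∈ Finset.range (X t m ω), Y m j ω) ^ k ∂μ ≤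
      Real.exp 1 * r ^ k * (k / Real.log (k + 2)) ^ k *
        (D * (m : ℝ) ^ (2 * (k : ℝ) - 3 * α)) := by
    rw [← ENNReal.ofReal_mul (by positivity)] at hS'
    have h := enorm_integral_le_lintegral_enorm (μ := μ)
      fun ω => (∑ j ∈ Finset.range (X t m ω), Y m j ω) ^ k
    simp_rw [enorm_pow] at h
    have h' := h.trans hS'
    rw [← ofReal_norm, ENNReal.ofReal_le_ofReal_iff (by positivity)] at h'
    exact (Real.le_norm_self _).trans h'
  have hR : (1 : ℝ) ≤ (k + 1) / Real.log (k + 2) := by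
    rw [one_le_div hlog]
    linarith [Real.log_le_sub_one_of_pos (show (0 : ℝ) < k + 2 by linarith)]
  have hkR : ((k : ℝ) / Real.log (k + 2)) ^ k ≤ ((k + 1) / Real.log (k + 2)) ^ (k + 1) := by
    refine le_trans ?_ (pow_le_pow_right₀ hR (Nat.le_succ k))
    gcongr
    linarith
  have hB : Real.exp 1 * D ≤ (Real.exp 1 * D + 1) ^ k := by
    refine le_trans (by linarith) (le_self_pow₀ ?_ (by omega))
    linarith [show 0 < Real.exp 1 * D by positivity]
  have hpow : (1 / (m : ℝ)) ^ k * ((m : ℝ) ^ (2 * α)) ^ k * (m : ℝ) ^ (2 * (k : ℝ) - 3 * α) =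
      (m : ℝ) ^ ((k : ℝ) + 2 * α * k - 3 * α) := by
    rw [one_div, ← Real.rpow_neg_one, ← Real.rpow_mul_natCast hm0.le,
      ← Real.rpow_mul_natCast hm0.le, ← Real.rpow_add hm0, ← Real.rpow_add hm0]
    congr 1
    ring
  simp_rw [subProc, mul_pow]
  rw [integral_const_mul]
  calc _ ≤ (1 / (m : ℝ)) ^ k * (Real.exp 1 * r ^ k * (k / Real.log (k + 2)) ^ k *
        (D * (m : ℝ) ^ (2 * (k : ℝ) - 3 * α))) := by gcongr
    _ = (Real.exp 1 * D) / Real.Gamma (1 - α) ^ k * t ^ k *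
        (m : ℝ) ^ ((k : ℝ) + 2 * α * k - 3 * α) * (k / Real.log (k + 2)) ^ k := by
        rw [← hpow, hrdef, poissonRate, div_pow _ (Real.Gamma (1 - α)), mul_pow t]
        ring
    _ ≤ _ := by
        rw [div_pow (Real.exp 1 * D + 1)]
        gcongr
end

section
/- Let α ∈ (0,1), let N ≥ 2 be an integer and β ∈ ℂ with Re((−i)^N·β·λ^N) ≤ 0 for every λ ∈ ℝ. Let μ be a complex measure on ℝ of finite total variation with compact support and set f(x) = ∫_ℝ e^{−iλx} dμ(λ) and u(t,x) = ∫_ℝ e^{−iλx}·E_α((β/N!)·(−iλ)^N·t^α) dμ(λ) for t ≥ 0, x ∈ ℝ. Then u(0,x) = f(x), and u solves the Caputo time-fractional equation: for every t > 0 and x ∈ ℝ, (1/Γ(1−α))·∫_0^t (t−s)^{−α}·∂_s u(s,x) ds = (β/N!)·∂_x^N u(t,x). -/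
open MeasureTheory Filter

/-- The Mittag-Leffler function `E_α(z) = ∑ z^k / Γ(αk+1)`. -/
noncomputable def mittagLeffler (α : ℝ) (z : ℂ) : ℂ :=
  ∑' k : ℕ, z ^ k / ((Real.Gamma (α * k + 1) : ℝ) : ℂ)

/-- `u(t,x) = ∫ e^{-iλx} E_α((β/N!) (-iλ)^N t^α) dμ(λ)`, where the complex measure `dμ`
is encoded as `ρ dν`. -/
noncomputable def uCaputo (N : ℕ) (β : ℂ) (α : ℝ) (ν : Measure ℝ) (ρ : ℝ → ℂ)
    (t x : ℝ) : ℂ :=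
  ∫ lam : ℝ, Complex.exp (-Complex.I * (lam : ℂ) * (x : ℂ)) *
    mittagLeffler α ((β / (Nat.factorial N : ℂ)) * (-Complex.I * (lam : ℂ)) ^ N *
      ((t ^ α : ℝ) : ℂ)) * ρ lam ∂ν

lemma rpow_mul_exp_neg_le_Gamma_add_one {M y : ℝ} (hM : 0 < M) (hy : 0 ≤ y) :
    M ^ y * Real.exp (-M) ≤ Real.Gamma (y + 1) := by
  have hint := Real.GammaIntegral_convergent (s := y + 1) (by linarith)
  rw [Real.Gamma_eq_integral (by linarith), ← integral_exp_neg_Ioi M, ← integral_const_mul]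
  have hsub : Set.Ioi M ⊆ Set.Ioi (0 : ℝ) := Set.Ioi_subset_Ioi hM.le
  refine (setIntegral_mono_on ((integrableOn_exp_neg_Ioi M).const_mul _) (hint.mono_set hsub)
    measurableSet_Ioi fun x hx => ?_).trans
    (setIntegral_mono_set hint ?_ (Eventually.of_forall hsub))
  · have hx' : M ≤ x := le_of_lt hx
    rw [mul_comm, add_sub_cancel_right]
    gcongr
  · filter_upwards [ae_restrict_mem measurableSet_Ioi] with x hx
    have : (0 : ℝ) < x := hx
    simp only [Pi.zero_apply]
    positivity

lemma Gamma_mul_natCast_add_one_pos {α : ℝ} (hα : 0 < α) (k : ℕ) :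
    0 < Real.Gamma (α * k + 1) :=
  Real.Gamma_pos_of_pos (by positivity)

lemma summable_pow_div_Gamma {α : ℝ} (hα : 0 < α) {r : ℝ} (hr : 0 ≤ r) :
    Summable fun k : ℕ => r ^ k / Real.Gamma (α * k + 1) := by
  set M : ℝ := (2 * r + 1) ^ (1 / α) with hM
  have hMpos : 0 < M := by positivity
  have hMα : M ^ α = 2 * r + 1 := by
    rw [hM, ← Real.rpow_mul (by positivity), one_div_mul_cancel hα.ne', Real.rpow_one]
  refine Summable.of_nonneg_of_le (fun k => ?_) (fun k => ?_)
    ((summable_geometric_two).mul_left (Real.exp M))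
  · have := Gamma_mul_natCast_add_one_pos hα k
    positivity
  · have h := rpow_mul_exp_neg_le_Gamma_add_one hMpos (y := α * k) (by positivity)
    rw [Real.rpow_mul hMpos.le, hMα, Real.rpow_natCast, Real.exp_neg] at h
    rw [div_le_iff₀ (Gamma_mul_natCast_add_one_pos hα k)]
    have h2 : r ^ k ≤ (1 / 2) ^ k * (2 * r + 1) ^ k := by
      rw [← mul_pow]
      gcongr
      linarith
    calc r ^ k ≤ (1 / 2) ^ k * (2 * r + 1) ^ k := h2
      _ = Real.exp M * (1 / 2) ^ k * ((2 * r + 1) ^ k * (Real.exp M)⁻¹) := by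
        field_simp
      _ ≤ _ := by gcongr

lemma norm_pow_div_Gamma {α : ℝ} (hα : 0 < α) (z : ℂ) (k : ℕ) :
    ‖z ^ k / ((Real.Gamma (α * k + 1) : ℝ) : ℂ)‖ = ‖z‖ ^ k / Real.Gamma (α * k + 1) := by
  rw [norm_div, norm_pow, Complex.norm_real, Real.norm_of_nonneg
    (Gamma_mul_natCast_add_one_pos hα k).le]

lemma mittagLeffler_zero (α : ℝ) : mittagLeffler α 0 = 1 := by
  rw [mittagLeffler, tsum_eq_single 0 fun k hk => by simp [hk]]
  simp

lemma continuous_mittagLeffler {α : ℝ} (hα : 0 < α) : Continuous (mittagLeffler α) := by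
  rw [continuous_iff_continuousAt]
  intro z
  have h : ContinuousOn (mittagLeffler α) (Metric.ball 0 (‖z‖ + 1)) := by
    refine continuousOn_tsum (fun k => by fun_prop)
      (summable_pow_div_Gamma hα (r := ‖z‖ + 1) (by positivity)) fun k w hw => ?_
    rw [norm_pow_div_Gamma hα]
    have := Gamma_mul_natCast_add_one_pos hα k
    have hw' : ‖w‖ ≤ ‖z‖ + 1 := by simpa using (Metric.mem_ball.1 hw).le
    gcongr
  exact h.continuousAt (Metric.isOpen_ball.mem_nhds (by simp))

lemma norm_mittagLeffler_le {α : ℝ} (hα : 0 < α) {z : ℂ} {r : ℝ} (hz : ‖z‖ ≤ r) :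
    ‖mittagLeffler α z‖ ≤ ∑' k : ℕ, r ^ k / Real.Gamma (α * k + 1) := by
  refine tsum_of_norm_bounded (summable_pow_div_Gamma hα ((norm_nonneg z).trans hz)).hasSum
    fun k => ?_
  rw [norm_pow_div_Gamma hα]
  have := Gamma_mul_natCast_add_one_pos hα k
  gcongr

section Integral

variable {X : Type*} [MeasurableSpace X] {ν : Measure X} {φ c : X → ℂ} {B : ℝ}

lemma integrable_pow_mul (hφ : Integrable φ ν) (hc : AEStronglyMeasurable c ν)
    (hB : ∀ᵐ y ∂ν, ‖c y‖ ≤ B) (k : ℕ) : Integrable (fun y => c y ^ k * φ y) ν := by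
  refine hφ.bdd_mul (hc.pow k) (c := B ^ k) ?_
  filter_upwards [hB] with y hy
  rw [norm_pow]
  gcongr

lemma integral_norm_pow_mul_le (hφ : Integrable φ ν) (hc : AEStronglyMeasurable c ν)
    (hB : ∀ᵐ y ∂ν, ‖c y‖ ≤ B) (k : ℕ) :
    ∫ y, ‖c y ^ k * φ y‖ ∂ν ≤ B ^ k * ∫ y, ‖φ y‖ ∂ν := by
  rw [← integral_const_mul]
  refine integral_mono_ae (integrable_pow_mul hφ hc hB k).norm (hφ.norm.const_mul _) ?_
  filter_upwards [hB] with y hy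
  rw [norm_mul, norm_pow]
  gcongr

lemma integrable_mittagLeffler_mul {α : ℝ} (hα : 0 < α) (hφ : Integrable φ ν)
    (hc : AEStronglyMeasurable c ν) (hB : ∀ᵐ y ∂ν, ‖c y‖ ≤ B) (z : ℂ) :
    Integrable (fun y => mittagLeffler α (c y * z) * φ y) ν := by
  refine hφ.bdd_mul ((continuous_mittagLeffler hα).comp_aestronglyMeasurable (hc.mul_const z)) ?_
    (c := ∑' k : ℕ, (B * ‖z‖) ^ k / Real.Gamma (α * k + 1))
  filter_upwards [hB] with y hy
  refine norm_mittagLeffler_le hα ?_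
  rw [norm_mul]
  gcongr

lemma integral_mittagLeffler_mul {α : ℝ} (hα : 0 < α) (hφ : Integrable φ ν)
    (hc : AEStronglyMeasurable c ν) (hB0 : 0 ≤ B) (hB : ∀ᵐ y ∂ν, ‖c y‖ ≤ B) (z : ℂ) :
    ∫ y, mittagLeffler α (c y * z) * φ y ∂ν =
      ∑' k : ℕ, (∫ y, c y ^ k * φ y ∂ν) * (z ^ k / ((Real.Gamma (α * k + 1) : ℝ) : ℂ)) := by
  have hF : ∀ (k : ℕ) (y : X), (c y * z) ^ k / ((Real.Gamma (α * k + 1) : ℝ) : ℂ) * φ y =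
      (c y ^ k * φ y) * (z ^ k / ((Real.Gamma (α * k + 1) : ℝ) : ℂ)) := by
    intro k y
    rw [mul_pow]
    ring
  have hsum : Summable fun k : ℕ =>
      ∫ y, ‖(c y ^ k * φ y) * (z ^ k / ((Real.Gamma (α * k + 1) : ℝ) : ℂ))‖ ∂ν := by
    refine Summable.of_nonneg_of_le (fun k => integral_nonneg fun y => norm_nonneg _)
      (fun k => ?_) ((summable_pow_div_Gamma hα (r := B * ‖z‖) (by positivity)).mul_left
        (∫ y, ‖φ y‖ ∂ν))
    simp_rw [norm_mul _ (z ^ k / _)]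
    rw [integral_mul_const, norm_pow_div_Gamma hα]
    have := Gamma_mul_natCast_add_one_pos hα k
    refine (mul_le_mul_of_nonneg_right (integral_norm_pow_mul_le hφ hc hB k)
      (by positivity)).trans_eq ?_
    rw [mul_pow]
    ring
  have h := (hasSum_integral_of_summable_integral_norm
    (fun k => (integrable_pow_mul hφ hc hB k).mul_const _) hsum).tsum_eq
  simp_rw [integral_mul_const] at h
  rw [h]
  refine integral_congr_ae (Eventually.of_forall fun y => ?_)
  simp only [mittagLeffler]
  rw [← tsum_mul_right]
  exact tsum_congr fun k => hF k y

end Integral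

lemma norm_exp_neg_I_mul_mul (l x : ℝ) :
    ‖Complex.exp (-Complex.I * (l : ℂ) * (x : ℂ))‖ = 1 := by
  rw [show -Complex.I * (l : ℂ) * (x : ℂ) = ((-(l * x) : ℝ) : ℂ) * Complex.I by push_cast; ring]
  exact Complex.norm_exp_ofReal_mul_I _

lemma integrable_exp_mul {ν : Measure ℝ} {h : ℝ → ℂ} (hh : Integrable h ν) (x : ℝ) :
    Integrable (fun l : ℝ => Complex.exp (-Complex.I * (l : ℂ) * (x : ℂ)) * h l) ν :=
  hh.bdd_mul (c := 1) (Continuous.aestronglyMeasurable (by fun_prop))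
    (Eventually.of_forall fun l => (norm_exp_neg_I_mul_mul l x).le)

lemma iteratedDeriv_integral_exp_mul {ν : Measure ℝ} {R : ℝ} (hR : ∀ᵐ l ∂ν, |l| ≤ R) (n : ℕ) :
    ∀ h : ℝ → ℂ, Integrable h ν →
    iteratedDeriv n (fun x : ℝ => ∫ l : ℝ, Complex.exp (-Complex.I * (l : ℂ) * (x : ℂ)) * h l ∂ν) =
      fun x : ℝ => ∫ l : ℝ, Complex.exp (-Complex.I * (l : ℂ) * (x : ℂ)) *
        ((-Complex.I * (l : ℂ)) ^ n * h l) ∂ν := by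
  induction n with
  | zero => intro h _; simp
  | succ n ih =>
    intro h hh
    have hbound : ∀ᵐ l : ℝ ∂ν, ‖-Complex.I * (l : ℂ)‖ ≤ R := by
      filter_upwards [hR] with l hl
      simpa using hl
    have hh' : Integrable (fun l : ℝ => (-Complex.I * (l : ℂ)) * h l) ν :=
      hh.bdd_mul (Continuous.aestronglyMeasurable (by fun_prop)) hbound
    have hderiv : deriv (fun x : ℝ => ∫ l : ℝ,
        Complex.exp (-Complex.I * (l : ℂ) * (x : ℂ)) * h l ∂ν) =
        fun x : ℝ => ∫ l : ℝ, Complex.exp (-Complex.I * (l : ℂ) * (x : ℂ)) *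
          ((-Complex.I * (l : ℂ)) * h l) ∂ν := by
      funext x
      refine (hasDerivAt_integral_of_dominated_loc_of_deriv_le (s := Set.univ)
        (F' := fun (x : ℝ) (l : ℝ) => Complex.exp (-Complex.I * (l : ℂ) * (x : ℂ)) *
          ((-Complex.I * (l : ℂ)) * h l))
        (bound := fun l : ℝ => ‖(-Complex.I * (l : ℂ)) * h l‖) univ_mem
        (Eventually.of_forall fun x => (integrable_exp_mul hh x).aestronglyMeasurable)
        (integrable_exp_mul hh x) (integrable_exp_mul hh' x).aestronglyMeasurable
        (Eventually.of_forall fun l x _ => ?_) hh'.norm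
        (Eventually.of_forall fun l x _ => ?_)).2.deriv
      · rw [norm_mul, norm_exp_neg_I_mul_mul, one_mul]
      · have h1 : HasDerivAt (fun x : ℝ => -Complex.I * (l : ℂ) * (x : ℂ))
            (-Complex.I * (l : ℂ)) x := by
          simpa using (Complex.ofRealCLM.hasDerivAt (x := x)).const_mul (-Complex.I * (l : ℂ))
        simpa [mul_assoc] using h1.cexp.mul_const (h l)
    rw [iteratedDeriv_succ', hderiv, ih _ hh']
    simp only [pow_succ, mul_assoc]

lemma setIntegral_rpow_mul_rpow {α p t : ℝ} (hα : α < 1) (hp : 0 < p) (ht : 0 < t) :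
    ∫ s in Set.Ioc (0 : ℝ) t, (t - s) ^ (-α) * s ^ (p - 1) =
      Real.Gamma (1 - α) * Real.Gamma p / Real.Gamma (p + 1 - α) * t ^ (p - α) := by
  have hG := Complex.Gamma_mul_Gamma_eq_betaIntegral (s := (p : ℂ)) (t := ((1 - α : ℝ) : ℂ))
    (by simpa using hp) (by rw [Complex.ofReal_re]; linarith)
  have hB := Complex.betaIntegral_scaled (p : ℂ) ((1 - α : ℝ) : ℂ) ht
  have hpos : 0 < Real.Gamma (p + 1 - α) := Real.Gamma_pos_of_pos (by linarith)
  apply Complex.ofReal_injective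
  rw [← integral_complex_ofReal, ← intervalIntegral.integral_of_le ht.le]
  have hcongr : ∫ s in (0 : ℝ)..t, (((t - s) ^ (-α) * s ^ (p - 1) : ℝ) : ℂ) =
      ∫ x in (0 : ℝ)..t, (x : ℂ) ^ ((p : ℂ) - 1) * ((t : ℂ) - x) ^ (((1 - α : ℝ) : ℂ) - 1) := by
    refine intervalIntegral.integral_congr fun s hs => ?_
    rw [Set.uIcc_of_le ht.le] at hs
    have h1 : 0 ≤ t - s := sub_nonneg.2 hs.2
    rw [Complex.ofReal_mul, Complex.ofReal_cpow h1, Complex.ofReal_cpow hs.1, mul_comm]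
    push_cast
    congr 2
    ring
  rw [hcongr, hB]
  rw [← Complex.ofReal_add, Complex.Gamma_ofReal, Complex.Gamma_ofReal, Complex.Gamma_ofReal,
    show p + (1 - α) = p + 1 - α by ring] at hG
  have hne : ((Real.Gamma (p + 1 - α) : ℝ) : ℂ) ≠ 0 := by exact_mod_cast hpos.ne'
  have hbeta : (p : ℂ).betaIntegral ((1 - α : ℝ) : ℂ) =
      ((Real.Gamma (1 - α) * Real.Gamma p / Real.Gamma (p + 1 - α) : ℝ) : ℂ) := by
    push_cast
    rw [eq_div_iff hne]
    push_cast at hG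
    rw [mul_comm, ← hG, mul_comm]
  rw [hbeta, Complex.ofReal_mul _ (t ^ (p - α)), Complex.ofReal_cpow ht.le, mul_comm]
  congr 2
  push_cast
  ring

section Caputo

variable {α : ℝ} {m : ℕ → ℂ} {C B : ℝ}

lemma summable_mul_pow_div_Gamma (hα : 0 < α) (hB : 0 ≤ B) (hm : ∀ k, ‖m k‖ ≤ C * B ^ k)
    (z : ℂ) : Summable fun k : ℕ => m k * (z ^ k / ((Real.Gamma (α * k + 1) : ℝ) : ℂ)) := by
  refine Summable.of_norm_bounded
    ((summable_pow_div_Gamma hα (r := B * ‖z‖) (by positivity)).mul_left C) fun k => ?_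
  rw [norm_mul, norm_pow_div_Gamma hα, mul_pow, mul_div_assoc, ← mul_assoc]
  have := Gamma_mul_natCast_add_one_pos hα k
  gcongr
  exact hm k

lemma rpow_mul_natCast_sub_one {s : ℝ} (hs : 0 < s) (k : ℕ) :
    s ^ (α * k - 1) = (s ^ α) ^ k * s⁻¹ := by
  rw [Real.rpow_sub hs, Real.rpow_one, Real.rpow_mul hs.le, Real.rpow_natCast, div_eq_mul_inv]

lemma hasDerivAt_rpow_pow {s : ℝ} (hs : 0 < s) (k : ℕ) :
    HasDerivAt (fun r : ℝ => (r ^ α) ^ k) (α * k * s ^ (α * k - 1)) s := by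
  refine (Real.hasDerivAt_rpow_const (Or.inl hs.ne')).congr_of_eventuallyEq ?_
  filter_upwards [lt_mem_nhds hs] with r hr
  rw [Real.rpow_mul hr.le, Real.rpow_natCast]

lemma hasDerivAt_tsum_rpow_div_Gamma (hα : 0 < α) (hB : 0 ≤ B)
    (hm : ∀ k, ‖m k‖ ≤ C * B ^ k) {s : ℝ} (hs : 0 < s) :
    HasDerivAt
      (fun r : ℝ => ∑' k : ℕ, m k * (((r ^ α : ℝ) : ℂ) ^ k / ((Real.Gamma (α * k + 1) : ℝ) : ℂ)))
      (∑' k : ℕ, m (k + 1) * ((α * (k + 1 : ℕ) * s ^ (α * (k + 1 : ℕ) - 1) /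
        Real.Gamma (α * (k + 1 : ℕ) + 1) : ℝ) : ℂ)) s := by
  have hC : 0 ≤ C := by simpa using (norm_nonneg _).trans (hm 0)
  set g' : ℕ → ℝ → ℂ := fun k y =>
    m k * ((α * k * y ^ (α * k - 1) / Real.Gamma (α * k + 1) : ℝ) : ℂ) with hg'
  set u : ℕ → ℝ := fun k =>
    C * α * (s / 2)⁻¹ * ((2 * B * (2 * s) ^ α) ^ k / Real.Gamma (α * k + 1)) with hu
  have husum : Summable u := (summable_pow_div_Gamma hα (by positivity)).mul_left _
  have hmem : s ∈ Set.Ioo (s / 2) (2 * s) := ⟨by linarith, by linarith⟩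
  have hbound : ∀ k, ∀ y ∈ Set.Ioo (s / 2) (2 * s), ‖g' k y‖ ≤ u k := by
    intro k y hy
    have hy0 : 0 < y := by linarith [hy.1]
    have hG := Gamma_mul_natCast_add_one_pos hα k
    have hk : (k : ℝ) ≤ 2 ^ k := by exact_mod_cast Nat.lt_two_pow_self.le
    have hy2 : y ≤ 2 * s := hy.2.le
    have hy1 : s / 2 ≤ y := hy.1.le
    simp only [hg', hu]
    rw [norm_mul, Complex.norm_real, Real.norm_of_nonneg (by positivity),
      rpow_mul_natCast_sub_one hy0]
    calc ‖m k‖ * (α * k * ((y ^ α) ^ k * y⁻¹) / Real.Gamma (α * k + 1))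
        ≤ (C * B ^ k) * (α * 2 ^ k * (((2 * s) ^ α) ^ k * (s / 2)⁻¹) /
            Real.Gamma (α * k + 1)) := by
          gcongr
          exact hm k
      _ = _ := by
        rw [mul_pow, mul_pow]
        ring
  have key := hasDerivAt_tsum_of_isPreconnected husum isOpen_Ioo isPreconnected_Ioo
    (g := fun k (r : ℝ) =>
      m k * (((r ^ α : ℝ) : ℂ) ^ k / ((Real.Gamma (α * k + 1) : ℝ) : ℂ))) (g' := g')
    (fun k y hy => ?_) hbound hmem (summable_mul_pow_div_Gamma hα hB hm _) hmem
  · have hs' : Summable fun k => g' k s :=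
      Summable.of_norm_bounded husum fun k => hbound k s hmem
    rw [hs'.tsum_eq_zero_add] at key
    simpa [hg'] using key
  · have hy0 : 0 < y := by linarith [hy.1]
    have h := (((hasDerivAt_rpow_pow (α := α) hy0 k).div_const
      (Real.Gamma (α * k + 1))).ofReal_comp).const_mul (m k)
    simpa [hg'] using h

lemma setIntegral_kernel (hα0 : 0 < α) (hα : α < 1) {t : ℝ} (ht : 0 < t) (k : ℕ) :
    ∫ s in Set.Ioc (0 : ℝ) t, (t - s) ^ (-α) * (α * (k + 1 : ℕ) * s ^ (α * (k + 1 : ℕ) - 1) /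
        Real.Gamma (α * (k + 1 : ℕ) + 1)) =
      Real.Gamma (1 - α) * ((t ^ α) ^ k / Real.Gamma (α * k + 1)) := by
  have hp : 0 < α * (k + 1 : ℕ) := by positivity
  have hG := Real.Gamma_pos_of_pos hp
  have hrw : ∀ s : ℝ, (t - s) ^ (-α) * (α * (k + 1 : ℕ) * s ^ (α * (k + 1 : ℕ) - 1) /
        Real.Gamma (α * (k + 1 : ℕ) + 1)) =
      (Real.Gamma (α * (k + 1 : ℕ)))⁻¹ * ((t - s) ^ (-α) * s ^ (α * (k + 1 : ℕ) - 1)) := by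
    intro s
    rw [Real.Gamma_add_one hp.ne']
    field_simp
  simp_rw [hrw]
  rw [integral_const_mul, setIntegral_rpow_mul_rpow hα hp ht,
    show α * (k + 1 : ℕ) + 1 - α = α * k + 1 by push_cast; ring,
    show α * (k + 1 : ℕ) - α = α * k by push_cast; ring,
    Real.rpow_mul ht.le, Real.rpow_natCast]
  have := Gamma_mul_natCast_add_one_pos hα0 k
  field_simp

lemma integrableOn_kernel (hα0 : 0 < α) (hα : α < 1) {t : ℝ} (ht : 0 < t) (k : ℕ) :
    IntegrableOn (fun s : ℝ => (t - s) ^ (-α) *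
      (α * (k + 1 : ℕ) * s ^ (α * (k + 1 : ℕ) - 1) / Real.Gamma (α * (k + 1 : ℕ) + 1)))
      (Set.Ioc 0 t) := by
  refine Integrable.of_integral_ne_zero ?_
  rw [setIntegral_kernel hα0 hα ht]
  have h1 := Gamma_mul_natCast_add_one_pos hα0 k
  have h2 : 0 < Real.Gamma (1 - α) := Real.Gamma_pos_of_pos (by linarith)
  positivity

lemma caputo_tsum_rpow_div_Gamma (hα0 : 0 < α) (hα : α < 1) (hB : 0 ≤ B)
    (hm : ∀ k, ‖m k‖ ≤ C * B ^ k) {t : ℝ} (ht : 0 < t) :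
    ((1 / Real.Gamma (1 - α) : ℝ) : ℂ) *
        ∫ s in Set.Ioc (0 : ℝ) t, (((t - s) ^ (-α) : ℝ) : ℂ) *
          deriv (fun r : ℝ => ∑' k : ℕ,
            m k * (((r ^ α : ℝ) : ℂ) ^ k / ((Real.Gamma (α * k + 1) : ℝ) : ℂ))) s =
      ∑' k : ℕ, m (k + 1) * (((t ^ α : ℝ) : ℂ) ^ k / ((Real.Gamma (α * k + 1) : ℝ) : ℂ)) := by
  set κ : ℕ → ℝ → ℝ := fun k s => (t - s) ^ (-α) *
    (α * (k + 1 : ℕ) * s ^ (α * (k + 1 : ℕ) - 1) / Real.Gamma (α * (k + 1 : ℕ) + 1)) with hκ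
  have hκint : ∀ k, ∫ s in Set.Ioc (0 : ℝ) t, κ k s =
      Real.Gamma (1 - α) * ((t ^ α) ^ k / Real.Gamma (α * k + 1)) :=
    setIntegral_kernel hα0 hα ht
  have hκ0 : ∀ k, ∀ s ∈ Set.Ioc (0 : ℝ) t, 0 ≤ κ k s := by
    intro k s hs
    have h1 : 0 ≤ t - s := sub_nonneg.2 hs.2
    have h2 := Gamma_mul_natCast_add_one_pos hα0 (k + 1)
    have h3 := hs.1
    positivity
  have hGα : 0 < Real.Gamma (1 - α) := Real.Gamma_pos_of_pos (by linarith)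
  have hnorm : ∀ k, ∫ s in Set.Ioc (0 : ℝ) t, ‖m (k + 1) * (κ k s : ℂ)‖ =
      Real.Gamma (1 - α) *
        ‖m (k + 1) * (((t ^ α : ℝ) : ℂ) ^ k / ((Real.Gamma (α * k + 1) : ℝ) : ℂ))‖ := by
    intro k
    rw [setIntegral_congr_fun (g := fun s => ‖m (k + 1)‖ * κ k s) measurableSet_Ioc
      fun s hs => by
        simp only [norm_mul, Complex.norm_real, Real.norm_of_nonneg (hκ0 k s hs)],
      integral_const_mul, hκint, norm_mul, norm_pow_div_Gamma hα0, Complex.norm_real,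
      Real.norm_of_nonneg (by positivity)]
    ring
  have hm' : ∀ k, ‖m (k + 1)‖ ≤ C * B * B ^ k := fun k =>
    (hm (k + 1)).trans_eq (by rw [pow_succ]; ring)
  have hsum : Summable fun k => ∫ s in Set.Ioc (0 : ℝ) t, ‖m (k + 1) * (κ k s : ℂ)‖ := by
    simp_rw [hnorm]
    exact (summable_mul_pow_div_Gamma (m := fun k => m (k + 1)) hα0 hB hm' _).norm.mul_left _
  have hmain := (hasSum_integral_of_summable_integral_norm
    (fun k => ((integrableOn_kernel hα0 hα ht k).ofReal (𝕜 := ℂ)).const_mul (m (k + 1)))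
    hsum).tsum_eq
  have hcongr : ∫ s in Set.Ioc (0 : ℝ) t, (((t - s) ^ (-α) : ℝ) : ℂ) *
      deriv (fun r : ℝ => ∑' k : ℕ,
        m k * (((r ^ α : ℝ) : ℂ) ^ k / ((Real.Gamma (α * k + 1) : ℝ) : ℂ))) s =
      ∫ s in Set.Ioc (0 : ℝ) t, ∑' k : ℕ, m (k + 1) * (κ k s : ℂ) := by
    refine setIntegral_congr_fun measurableSet_Ioc fun s hs => ?_
    rw [(hasDerivAt_tsum_rpow_div_Gamma hα0 hB hm hs.1).deriv, ← tsum_mul_left]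
    refine tsum_congr fun k => ?_
    simp only [hκ]
    rw [Complex.ofReal_mul ((t - s) ^ (-α))]
    ring
  rw [hcongr]
  refine (congrArg _ hmain.symm).trans ?_
  rw [← tsum_mul_left]
  refine tsum_congr fun k => ?_
  have hk : ∫ s in Set.Ioc (0 : ℝ) t, m (k + 1) * (κ k s : ℂ) =
      m (k + 1) * ((Real.Gamma (1 - α) * ((t ^ α) ^ k / Real.Gamma (α * k + 1)) : ℝ) : ℂ) := by
    rw [integral_const_mul, integral_complex_ofReal, hκint]
  refine (congrArg _ hk).trans ?_
  have hne : ((Real.Gamma (1 - α) : ℝ) : ℂ) ≠ 0 := by exact_mod_cast hGα.ne'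
  push_cast
  field_simp

end Caputo

theorem stmt_18
    (α : ℝ) (hα : α ∈ Set.Ioo (0 : ℝ) 1)
    (N : ℕ) (hN : 2 ≤ N) (β : ℂ)
    (hsign : ∀ lam : ℝ, ((-Complex.I) ^ N * β * (lam : ℂ) ^ N).re ≤ 0)
    (ν : Measure ℝ) [IsFiniteMeasure ν] (ρ : ℝ → ℂ) (hρ : Integrable ρ ν)
    (hsupp : ∃ R : ℝ, ν {y : ℝ | R < |y|} = 0)
    (f : ℝ → ℂ)
    (hf : ∀ x : ℝ, f x = ∫ lam : ℝ, Complex.exp (-Complex.I * (lam : ℂ) * (x : ℂ)) * ρ lam ∂ν) :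
    (∀ x : ℝ, uCaputo N β α ν ρ 0 x = f x) ∧
    (∀ t : ℝ, 0 < t → ∀ x : ℝ,
      ((1 / Real.Gamma (1 - α) : ℝ) : ℂ) *
          ∫ s in Set.Ioc (0 : ℝ) t, (((t - s) ^ (-α) : ℝ) : ℂ) *
            deriv (fun r : ℝ => uCaputo N β α ν ρ r x) s =
        (β / (Nat.factorial N : ℂ)) *
          iteratedDeriv N (fun x' : ℝ => uCaputo N β α ν ρ t x') x) := by
  obtain ⟨hα0, hα1⟩ := hα
  obtain ⟨R, hR⟩ := hsupp
  have hRae : ∀ᵐ l ∂ν, |l| ≤ R := by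
    rw [ae_iff]
    simpa only [not_le] using hR
  set c : ℝ → ℂ := fun l => (β / (Nat.factorial N : ℂ)) * (-Complex.I * (l : ℂ)) ^ N with hc
  have hcm : AEStronglyMeasurable c ν := Continuous.aestronglyMeasurable (by fun_prop)
  set B : ℝ := ‖β / (Nat.factorial N : ℂ)‖ * |R| ^ N with hBdef
  have hB0 : 0 ≤ B := by positivity
  have hB : ∀ᵐ l ∂ν, ‖c l‖ ≤ B := by
    filter_upwards [hRae] with l hl
    simp only [hc, hBdef, norm_mul, norm_pow, norm_neg, Complex.norm_I, Complex.norm_real, one_mul,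
      Real.norm_eq_abs]
    exact mul_le_mul_of_nonneg_left
      (pow_le_pow_left₀ (abs_nonneg l) (hl.trans (le_abs_self R)) N) (norm_nonneg _)
  set φ : ℝ → ℝ → ℂ := fun x l => Complex.exp (-Complex.I * (l : ℂ) * (x : ℂ)) * ρ l with hφdef
  have hφ : ∀ x, Integrable (φ x) ν := integrable_exp_mul hρ
  have hu : ∀ r x, uCaputo N β α ν ρ r x = ∑' k : ℕ, (∫ l, c l ^ k * φ x l ∂ν) *
      (((r ^ α : ℝ) : ℂ) ^ k / ((Real.Gamma (α * k + 1) : ℝ) : ℂ)) := by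
    intro r x
    rw [← integral_mittagLeffler_mul hα0 (hφ x) hcm hB0 hB, uCaputo]
    refine integral_congr_ae (Eventually.of_forall fun l => ?_)
    simp only [hφdef, hc]
    ring
  refine ⟨fun x => ?_, fun t ht x => ?_⟩
  · rw [hf, uCaputo]
    simp [Real.zero_rpow hα0.ne', mittagLeffler_zero]
  · have hm : ∀ k, ‖∫ l, c l ^ k * φ x l ∂ν‖ ≤ (∫ l, ‖φ x l‖ ∂ν) * B ^ k := fun k =>
      (norm_integral_le_integral_norm _).trans
        ((integral_norm_pow_mul_le (hφ x) hcm hB k).trans_eq (mul_comm _ _))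
    simp_rw [fun r => hu r x]
    rw [caputo_tsum_rpow_div_Gamma hα0 hα1 hB0 hm ht]
    have hEρ := integrable_mittagLeffler_mul hα0 hρ hcm hB ((t ^ α : ℝ) : ℂ)
    have hux : (fun x' : ℝ => uCaputo N β α ν ρ t x') = fun x' : ℝ =>
        ∫ l : ℝ, Complex.exp (-Complex.I * (l : ℂ) * (x' : ℂ)) *
          (mittagLeffler α (c l * ((t ^ α : ℝ) : ℂ)) * ρ l) ∂ν := by
      funext x'
      simp only [uCaputo, hc, mul_assoc]
    rw [hux, iteratedDeriv_integral_exp_mul hRae N _ hEρ, ← integral_const_mul]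
    have hcφ : Integrable (fun l => c l * φ x l) ν := by
      simpa using integrable_pow_mul (hφ x) hcm hB 1
    have h := integral_mittagLeffler_mul hα0 hcφ hcm hB0 hB ((t ^ α : ℝ) : ℂ)
    simp only [← mul_assoc (c _ ^ _), ← pow_succ] at h
    refine h.symm.trans (integral_congr_ae (Eventually.of_forall fun l => ?_))
    simp only [hφdef, hc]
    ring
end

section
/- Let M ∈ ℕ, M > 1, and set α = 1/M. Let N ≥ 2 be an integer and β ∈ ℂ with Re((−i)^N·β·λ^N) ≤ 0 for every λ ∈ ℝ. Let μ be a complex measure on ℝ of finite total variation with compact support, f(x) = ∫_ℝ e^{−iλx} dμ(λ), and u(t,x) = ∫_ℝ e^{−iλx}·E_α(Ψ(λ)·t^α) dμ(λ), where Ψ(λ) = (β/N!)·(−iλ)^N. Then u also solves the integer-order diffusion equation with non-local forcing term: for every t > 0 and x ∈ ℝ, ∂_t u(t,x) = ∫_ℝ e^{−iλx}·Ψ(λ)^M·E_α(Ψ(λ)·t^α) dμ(λ) + Σ_{k=1}^{M−1} (t^{αk−1}/Γ(αk))·∫_ℝ e^{−iλx}·Ψ(λ)^k dμ(λ), i.e.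 u solves ∂_t u = (A_{N,β})^{1/α} u + Σ_{k=1}^{1/α−1} (t^{αk−1}/Γ(αk))·(A_{N,β})^k f with u(0,·) = f, where the powers of A_{N,β} act as the Fourier multipliers Ψ(λ)^k. -/
open MeasureTheory Filter

/-- The symbol `Ψ(λ) = (β/N!)(-iλ)^N` of the operator `A_{N,β}`. -/
noncomputable def symb (N : ℕ) (β : ℂ) (lam : ℝ) : ℂ :=
  (β / (Nat.factorial N : ℂ)) * (-Complex.I * (lam : ℂ)) ^ N

/-- `u(t,x) = ∫ e^{-iλx} E_α(Ψ(λ) t^α) dμ(λ)`, where the complex measure `dμ` is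
encoded as `ρ dν`. -/
noncomputable def uML (N : ℕ) (β : ℂ) (α : ℝ) (ν : Measure ℝ) (ρ : ℝ → ℂ)
    (t x : ℝ) : ℂ :=
  ∫ lam : ℝ, Complex.exp (-Complex.I * (lam : ℂ) * (x : ℂ)) *
    mittagLeffler α (symb N β lam * ((t ^ α : ℝ) : ℂ)) * ρ lam ∂ν

theorem summable_pow_div_factorial_div (M : ℕ) (hM : 0 < M) {r : ℝ} (hr : 0 ≤ r) :
    Summable fun k : ℕ => r ^ k / ((k / M).factorial : ℝ) := by
  have : NeZero M := ⟨hM.ne'⟩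
  have h1 : Summable fun q : ℕ => (r ^ M) ^ q / (q.factorial : ℝ) :=
    Real.summable_pow_div_factorial _
  have h2 : Summable fun j : Fin M => r ^ (j : ℕ) := Summable.of_finite
  have h3 := h1.mul_of_nonneg h2 (fun q => by positivity) (fun j => by positivity)
  rw [← (Nat.divModEquiv M).symm.summable_iff]
  refine h3.congr ?_
  rintro ⟨q, j⟩
  have hq : (q * M + (j : ℕ)) / M = q := by
    rw [Nat.mul_comm, Nat.mul_add_div hM, Nat.div_eq_of_lt j.isLt, add_zero]
  simp only [Function.comp, Nat.divModEquiv_symm_apply, hq]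
  rw [← pow_mul, pow_add, Nat.mul_comm q M]
  ring

theorem factorial_div_le_Gamma (M : ℕ) (hM : 0 < M) {k : ℕ} (hk : M ≤ k) :
    ((k / M).factorial : ℝ) ≤ Real.Gamma (1 / (M : ℝ) * k + 1) := by
  have hM' : (0 : ℝ) < M := by exact_mod_cast hM
  have h1 : 1 ≤ k / M := (Nat.one_le_div_iff hM).2 hk
  have h1' : (1 : ℝ) ≤ ((k / M : ℕ) : ℝ) := by exact_mod_cast h1
  have h2 : ((k / M : ℕ) : ℝ) ≤ 1 / (M : ℝ) * k := by
    have := @Nat.cast_div_le ℝ _ _ _ k M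
    calc _ ≤ (k : ℝ) / M := this
      _ = _ := by ring
  rw [← Real.Gamma_nat_eq_factorial]
  refine Real.Gamma_strictMonoOn_Ici.monotoneOn (Set.mem_Ici.2 ?_) (Set.mem_Ici.2 ?_) ?_ <;> linarith

theorem summable_mittagLeffler_norm (M : ℕ) (hM : 0 < M) {r : ℝ} (hr : 0 ≤ r) :
    Summable fun k : ℕ => r ^ k / Real.Gamma (1 / (M : ℝ) * k + 1) := by
  refine Summable.of_norm_bounded_eventually_nat (summable_pow_div_factorial_div M hM hr) ?_
  filter_upwards [eventually_ge_atTop M] with k hk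
  have hf : (0 : ℝ) < ((k / M).factorial : ℝ) := by positivity
  have h := factorial_div_le_Gamma M hM hk
  rw [Real.norm_of_nonneg (div_nonneg (by positivity) (hf.le.trans h))]
  gcongr

theorem norm_mittagLeffler_term_le {α : ℝ} (hα : 0 ≤ α) (k : ℕ) {z : ℂ} {r : ℝ} (hz : ‖z‖ ≤ r) :
    ‖z ^ k / ((Real.Gamma (α * k + 1) : ℝ) : ℂ)‖ ≤ r ^ k / Real.Gamma (α * k + 1) := by
  have hG : 0 < Real.Gamma (α * k + 1) := Real.Gamma_pos_of_pos (by positivity)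
  rw [norm_div, norm_pow, Complex.norm_of_nonneg hG.le]
  gcongr

theorem differentiable_mittagLeffler (M : ℕ) (hM : 0 < M) :
    Differentiable ℂ (mittagLeffler (1 / (M : ℝ))) := by
  intro z
  have hU := Metric.isOpen_ball (x := (0 : ℂ)) (ε := ‖z‖ + 1)
  refine (Complex.differentiableOn_tsum_of_summable_norm
    (summable_mittagLeffler_norm M hM (by positivity : 0 ≤ ‖z‖ + 1)) (fun k => by fun_prop) hU
    (fun k w hw => norm_mittagLeffler_term_le (by positivity) k
      (mem_ball_zero_iff.1 hw).le)).differentiableAt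
    (hU.mem_nhds (mem_ball_zero_iff.2 (by linarith)))

theorem mul_div_Gamma_add_one (x : ℝ) : x / Real.Gamma (x + 1) = 1 / Real.Gamma x := by
  rcases eq_or_ne x 0 with rfl | hx
  · simp
  · rw [Real.Gamma_add_one hx]
    field_simp

theorem hasSum_mul_deriv_mittagLeffler (M : ℕ) (hM : 0 < M) (z : ℂ) :
    HasSum (fun k : ℕ => z ^ k / ((Real.Gamma (1 / (M : ℝ) * k) : ℝ) : ℂ))
      (1 / (M : ℂ) * z * deriv (mittagLeffler (1 / (M : ℝ))) z) := by
  have hU := Metric.isOpen_ball (x := (0 : ℂ)) (ε := ‖z‖ + 1)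
  have h := Complex.hasSum_deriv_of_summable_norm
    (F := fun (k : ℕ) (w : ℂ) => w ^ k / ((Real.Gamma (1 / (M : ℝ) * k + 1) : ℝ) : ℂ))
    (summable_mittagLeffler_norm M hM (by positivity : 0 ≤ ‖z‖ + 1)) (fun k => by fun_prop) hU
    (fun k w hw => norm_mittagLeffler_term_le (by positivity) k
      (mem_ball_zero_iff.1 hw).le) (mem_ball_zero_iff.2 (by linarith : ‖z‖ < ‖z‖ + 1))
  refine (h.mul_left (1 / (M : ℂ) * z)).congr_fun ?_
  intro k
  have h1 := congrArg (fun y : ℝ => (y : ℂ)) (mul_div_Gamma_add_one (1 / (M : ℝ) * k))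
  push_cast at h1
  rw [deriv_div_const, deriv_pow_field]
  rcases k with _ | k
  · simp
  · rw [div_eq_mul_one_div (z ^ (k + 1)), ← h1]
    push_cast
    rw [pow_succ]
    ring

theorem mul_deriv_mittagLeffler (M : ℕ) (hM : 0 < M) (z : ℂ) :
    1 / (M : ℂ) * z * deriv (mittagLeffler (1 / (M : ℝ))) z =
      z ^ M * mittagLeffler (1 / (M : ℝ)) z +
        ∑ k ∈ Finset.Icc 1 (M - 1), z ^ k / ((Real.Gamma (1 / (M : ℝ) * k) : ℝ) : ℂ) := by
  have hM' : (M : ℝ) ≠ 0 := by exact_mod_cast hM.ne'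
  have h := hasSum_mul_deriv_mittagLeffler M hM z
  rw [← h.tsum_eq, ← h.summable.sum_add_tsum_nat_add M, add_comm]
  congr 1
  · rw [mittagLeffler, ← tsum_mul_left]
    refine tsum_congr fun k => ?_
    have : 1 / (M : ℝ) * ((k + M : ℕ) : ℝ) = 1 / (M : ℝ) * k + 1 := by
      push_cast
      field_simp
    rw [this, pow_add]
    ring
  · have : Finset.Icc 1 (M - 1) = (Finset.range M).erase 0 := by
      ext k
      simp only [Finset.mem_Icc, Finset.mem_erase, Finset.mem_range]
      omega
    rw [this, Finset.sum_erase]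
    simp

theorem hasDerivAt_mittagLeffler_rpow (M : ℕ) (hM : 0 < M) (ψ : ℂ) {s : ℝ} (hs : 0 < s) :
    HasDerivAt (fun s : ℝ => mittagLeffler (1 / (M : ℝ)) (ψ * ((s ^ (1 / (M : ℝ)) : ℝ) : ℂ)))
      (ψ ^ M * mittagLeffler (1 / (M : ℝ)) (ψ * ((s ^ (1 / (M : ℝ)) : ℝ) : ℂ)) +
        ∑ k ∈ Finset.Icc 1 (M - 1),
          ((s ^ (1 / (M : ℝ) * k - 1) / Real.Gamma (1 / (M : ℝ) * k) : ℝ) : ℂ) * ψ ^ k) s := by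
  have hM' : (M : ℝ) ≠ 0 := by exact_mod_cast hM.ne'
  have hs' : (s : ℂ) ≠ 0 := by exact_mod_cast hs.ne'
  have h1 := ((Real.hasDerivAt_rpow_const (p := 1 / (M : ℝ)) (Or.inl hs.ne')).ofReal_comp).const_mul ψ
  have h2 := (differentiable_mittagLeffler M hM (ψ * ((s ^ (1 / (M : ℝ)) : ℝ) : ℂ))).hasDerivAt
  refine (h2.comp s h1).congr_deriv ?_
  have h3 := mul_deriv_mittagLeffler M hM (ψ * ((s ^ (1 / (M : ℝ)) : ℝ) : ℂ))
  have hpow (k : ℕ) : (s ^ (1 / (M : ℝ))) ^ k = s ^ (1 / (M : ℝ) * k) := by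
    rw [Real.rpow_mul hs.le, Real.rpow_natCast]
  have hpowM : (s ^ (1 / (M : ℝ))) ^ M = s := by
    rw [hpow, one_div_mul_cancel hM', Real.rpow_one]
  refine mul_right_cancel₀ hs' ?_
  rw [Real.rpow_sub_one hs.ne', add_mul, Finset.sum_mul]
  refine Eq.trans ?_ (h3.trans ?_)
  · push_cast
    field_simp
  · congr 1
    · rw [mul_pow, ← Complex.ofReal_pow, hpowM]
      ring
    · refine Finset.sum_congr rfl fun k _ => ?_
      rw [mul_pow, ← Complex.ofReal_pow, hpow, Real.rpow_sub_one hs.ne']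
      push_cast
      field_simp

theorem continuous_symb (N : ℕ) (β : ℂ) : Continuous (symb N β) := by
  unfold symb
  fun_prop

theorem MeasureTheory.Integrable.continuous_mul_of_bounded_support {ν : Measure ℝ} {ρ : ℝ → ℂ}
    (hρ : Integrable ρ ν) {R : ℝ} (hR : ∀ᵐ y ∂ν, |y| ≤ R) {g : ℝ → ℂ} (hg : Continuous g) :
    Integrable (fun y => g y * ρ y) ν := by
  obtain ⟨C, hC⟩ := (isCompact_Icc (a := -R) (b := R)).exists_bound_of_continuousOn hg.continuousOn
  refine hρ.bdd_mul (c := C) hg.aestronglyMeasurable ?_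
  filter_upwards [hR] with y hy
  exact hC y (abs_le.1 hy)

theorem stmt_19
    (M : ℕ) (hM : 1 < M) (α : ℝ) (hαM : α = 1 / (M : ℝ))
    (N : ℕ) (hN : 2 ≤ N) (β : ℂ)
    (hsign : ∀ lam : ℝ, ((-Complex.I) ^ N * β * (lam : ℂ) ^ N).re ≤ 0)
    (ν : Measure ℝ) [IsFiniteMeasure ν] (ρ : ℝ → ℂ) (hρ : Integrable ρ ν)
    (hsupp : ∃ R : ℝ, ν {y : ℝ | R < |y|} = 0)
    (f : ℝ → ℂ)
    (hf : ∀ x : ℝ, f x = ∫ lam : ℝ, Complex.exp (-Complex.I * (lam : ℂ) * (x : ℂ)) * ρ lam ∂ν) :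
    (∀ x : ℝ, uML N β α ν ρ 0 x = f x) ∧
    (∀ t : ℝ, 0 < t → ∀ x : ℝ,
      HasDerivAt (fun s : ℝ => uML N β α ν ρ s x)
        ((∫ lam : ℝ, Complex.exp (-Complex.I * (lam : ℂ) * (x : ℂ)) * symb N β lam ^ M *
            mittagLeffler α (symb N β lam * ((t ^ α : ℝ) : ℂ)) * ρ lam ∂ν) +
          ∑ k ∈ Finset.Icc 1 (M - 1),
            ((t ^ (α * k - 1) / Real.Gamma (α * k) : ℝ) : ℂ) *
              ∫ lam : ℝ, Complex.exp (-Complex.I * (lam : ℂ) * (x : ℂ)) *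
                symb N β lam ^ k * ρ lam ∂ν) t) := by
  subst hαM
  have hM0 : 0 < M := by omega
  have hE : Continuous (mittagLeffler (1 / (M : ℝ))) :=
    (differentiable_mittagLeffler M hM0).continuous
  have hΨ := continuous_symb N β
  obtain ⟨R, hR⟩ := hsupp
  have hR' : ∀ᵐ y ∂ν, |y| ≤ R := by
    rw [ae_iff]
    simpa only [not_le] using hR
  refine ⟨fun x => ?_, fun t ht x => ?_⟩
  · have hα : (1 / (M : ℝ)) ≠ 0 := by positivity
    have hE0 : mittagLeffler (1 / (M : ℝ)) 0 = 1 := by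
      rw [mittagLeffler, tsum_eq_single 0 (fun k hk => by simp [hk])]
      simp
    simp only [uML, hf, Real.zero_rpow hα, Complex.ofReal_zero, mul_zero, hE0, mul_one]
  · let D : ℝ → ℝ → ℂ := fun s y => Complex.exp (-Complex.I * (y : ℂ) * (x : ℂ)) *
      (symb N β y ^ M * mittagLeffler (1 / (M : ℝ)) (symb N β y * ((s ^ (1 / (M : ℝ)) : ℝ) : ℂ)) +
        ∑ k ∈ Finset.Icc 1 (M - 1),
          ((s ^ (1 / (M : ℝ) * k - 1) / Real.Gamma (1 / (M : ℝ) * k) : ℝ) : ℂ) * symb N β y ^ k)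
    have hDc : ContinuousOn (fun p : ℝ × ℝ => D p.1 p.2)
        (Set.Icc (t / 2) (2 * t) ×ˢ Set.Icc (-R) R) := by
      have hr (a : ℝ) : ContinuousOn (fun p : ℝ × ℝ => ((p.1 ^ a : ℝ) : ℂ))
          (Set.Icc (t / 2) (2 * t) ×ˢ Set.Icc (-R) R) :=
        Complex.continuous_ofReal.comp_continuousOn
          (continuousOn_fst.rpow_const fun p hp => Or.inl (by linarith [hp.1.1] : 0 < p.1).ne')
      have hs : Continuous fun p : ℝ × ℝ => symb N β p.2 := hΨ.comp continuous_snd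
      refine ContinuousOn.mul (by fun_prop) (ContinuousOn.add ?_ ?_)
      · exact (hs.pow M).continuousOn.mul (hE.comp_continuousOn (hs.continuousOn.mul (hr _)))
      · refine continuousOn_finsetSum _ fun k _ => ContinuousOn.mul ?_ (hs.pow k).continuousOn
        simp only [Complex.ofReal_div]
        exact (hr _).div_const _
    obtain ⟨C, hC⟩ := (isCompact_Icc.prod isCompact_Icc).exists_bound_of_continuousOn hDc
    have hFc (s : ℝ) : Continuous fun y : ℝ => Complex.exp (-Complex.I * (y : ℂ) * (x : ℂ)) *
        mittagLeffler (1 / (M : ℝ)) (symb N β y * ((s ^ (1 / (M : ℝ)) : ℝ) : ℂ)) := by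
      fun_prop
    have hDt : Continuous (D t) := by
      fun_prop
    have hmem : Set.Icc (t / 2) (2 * t) ∈ nhds t := Icc_mem_nhds (by linarith) (by linarith)
    have key := (hasDerivAt_integral_of_dominated_loc_of_deriv_le (μ := ν)
      (F := fun s y => Complex.exp (-Complex.I * (y : ℂ) * (x : ℂ)) *
        mittagLeffler (1 / (M : ℝ)) (symb N β y * ((s ^ (1 / (M : ℝ)) : ℝ) : ℂ)) * ρ y)
      (F' := fun s y => D s y * ρ y) (bound := fun y => C * ‖ρ y‖) hmem
      (Eventually.of_forall fun s =>
        (hρ.continuous_mul_of_bounded_support hR' (hFc s)).aestronglyMeasurable)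
      (hρ.continuous_mul_of_bounded_support hR' (hFc t))
      (hρ.continuous_mul_of_bounded_support hR' hDt).aestronglyMeasurable
      (by
        filter_upwards [hR'] with y hy s hs
        rw [norm_mul]
        gcongr
        exact hC (s, y) ⟨hs, abs_le.1 hy⟩)
      (hρ.norm.const_mul C)
      (Eventually.of_forall fun y s hs =>
        ((hasDerivAt_mittagLeffler_rpow M hM0 (symb N β y)
          (by linarith [hs.1] : 0 < s)).const_mul _).mul_const _)).2
    refine key.congr_deriv ?_
    have h1 := hρ.continuous_mul_of_bounded_support hR'
      (g := fun y : ℝ => Complex.exp (-Complex.I * (y : ℂ) * (x : ℂ)) * symb N β y ^ M *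
        mittagLeffler (1 / (M : ℝ)) (symb N β y * ((t ^ (1 / (M : ℝ)) : ℝ) : ℂ))) (by fun_prop)
    have h2 (k : ℕ) := hρ.continuous_mul_of_bounded_support hR'
      (g := fun y : ℝ => Complex.exp (-Complex.I * (y : ℂ) * (x : ℂ)) * symb N β y ^ k)
      (by fun_prop)
    simp only [← integral_const_mul]
    rw [← integral_finsetSum _ fun k _ => (h2 k).const_mul _,
      ← integral_add h1 (integrable_finsetSum _ fun k _ => (h2 k).const_mul _)]
    refine integral_congr_ae (Eventually.of_forall fun y => ?_)
    simp only [D, mul_add, add_mul, Finset.mul_sum, Finset.sum_mul]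
    congr 1
    · ring
    · exact Finset.sum_congr rfl fun k _ => by ring
end
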